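/- Let 1<p≤2. There is a constant c_p>0 depending only on p, b, c_+, c_- such that for every nonempty U⊂(0,∞), c_p ( √(log 𝔑(U)) + sup_{0<δ<1} 𝒦_p(U,δ) ) ≤ ‖𝓗^U‖_{L^p→L^p}. -/

import Mathlib

open MeasureTheory Filter Set Topology
open scoped ENNReal NNReal Topology Classical

noncomputable section

/-- The homogeneous curve of degree `b`: `γ_b(t) = c₊ t^b` for `t > 0`,
`γ_b(t) = c₋ (-t)^b` for `t < 0`, `γ_b(0) = 0`. -/
def curve (b cp cm t : ℝ) : ℝ :=
  if 0 < t then cp * t ^ b else if t < 0 then cm * (-t) ^ b else 0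

/-- The maximal function along the curve `(t, u γ_b(t))`. -/
def Mu (b cp cm u : ℝ) (f : ℝ × ℝ → ℝ) (x : ℝ × ℝ) : ℝ :=
  ⨆ R : {R : ℝ // 0 < R},
    ((R : ℝ))⁻¹ * ∫ t in (0:ℝ)..(R : ℝ), |f (x - (t, u * curve b cp cm t))|

/-- The maximal function `𝓜^U f = sup_{u ∈ U} M^{(u)} f`. -/
def calM (b cp cm : ℝ) (U : Set ℝ) (f : ℝ × ℝ → ℝ) (x : ℝ × ℝ) : ℝ :=
  ⨆ u : U, Mu b cp cm (u : ℝ) f x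

/-- The Hilbert transform along the curve `(t, u γ_b(t))` (principal value). -/
def Hu (b cp cm u : ℝ) (f : ℝ × ℝ → ℝ) (x : ℝ × ℝ) : ℝ :=
  limUnder (𝓝[>] (0:ℝ)) fun ε : ℝ =>
    ∫ t in {t : ℝ | ε < |t| ∧ |t| < ε⁻¹}, f (x - (t, u * curve b cp cm t)) / t

/-- The maximal function `𝓗^U f = sup_{u ∈ U} |H^{(u)} f|`, valued in `ℝ≥0∞`. -/
def calH (b cp cm : ℝ) (U : Set ℝ) (f : ℝ × ℝ → ℝ) (x : ℝ × ℝ) : ℝ≥0∞ :=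
  ⨆ u : U, ENNReal.ofReal |Hu b cp cm (u : ℝ) f x|

/-- The `L^p` norm of an `ℝ≥0∞`-valued function on `ℝ²`. -/
def lpN (g : ℝ × ℝ → ℝ≥0∞) (p : ℝ) : ℝ≥0∞ :=
  (∫⁻ x : ℝ × ℝ, g x ^ p) ^ (1 / p)

def eN (p : ℝ) : ℝ≥0∞ := ENNReal.ofReal p

/-- `U^r = r⁻¹ U ∩ [1,2] = {ρ ∈ [1,2] : rρ ∈ U}`. -/
def UrSet (U : Set ℝ) (r : ℝ) : Set ℝ := {ρ : ℝ | ρ ∈ Icc (1:ℝ) 2 ∧ r * ρ ∈ U}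

/-- `N(A,δ)`: minimal number of intervals of length `δ` needed to cover `A`. -/
def covN (A : Set ℝ) (δ : ℝ) : ℕ :=
  sInf {n : ℕ | ∃ F : Finset ℝ, F.card = n ∧ A ⊆ ⋃ a ∈ F, Icc a (a + δ)}

/-- `𝒦_p(U,δ) = δ^{1-1/p} sup_{r>0} N(U^r,δ)^{1/p}`. -/
def Kp (U : Set ℝ) (δ p : ℝ) : ℝ :=
  δ ^ (1 - 1 / p) * ⨆ r : {r : ℝ // 0 < r}, ((covN (UrSet U (r : ℝ)) δ : ℝ)) ^ (1 / p)

/-- `p_cr(U) = 1 + limsup_{δ→0+} sup_{r>0} log N(U^r,δ) / log(1/δ)`. -/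
def pcr (U : Set ℝ) : ℝ :=
  1 + limsup (fun δ : ℝ =>
      (⨆ r : {r : ℝ // 0 < r}, Real.log (covN (UrSet U (r : ℝ)) δ)) / Real.log δ⁻¹)
    (𝓝[>] (0:ℝ))

/-- `𝔑(U) = 1 + #{n ∈ ℤ : [2ⁿ, 2ⁿ⁺¹] ∩ U ≠ ∅}`. -/
def frakN (U : Set ℝ) : ℕ∞ :=
  1 + Set.encard {n : ℤ | (Icc ((2:ℝ) ^ n) ((2:ℝ) ^ (n + 1)) ∩ U).Nonempty}

/-- `√(log 𝔑(U))`, valued in `ℝ≥0∞` (equal to `∞` if `𝔑(U) = ∞`). -/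
def sqrtLogN (U : Set ℝ) : ℝ≥0∞ :=
  if frakN U = ⊤ then ⊤
  else ENNReal.ofReal (Real.sqrt (Real.log ((frakN U).toNat : ℝ)))

/-- The `L^p → L^p` operator norm of `𝓜^U` (smallest admissible constant, possibly `∞`). -/
def opNormM (b cp cm : ℝ) (U : Set ℝ) (p : ℝ) : ℝ≥0∞ :=
  sInf {C : ℝ≥0∞ | ∀ f : SchwartzMap (ℝ × ℝ) ℝ,
    eLpNorm (calM b cp cm U ⇑f) (eN p) volume ≤ C * eLpNorm ⇑f (eN p) volume}

/-- The `L^p → L^p` operator norm of `𝓗^U` (smallest admissible constant, possibly `∞`). -/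
def opNormH (b cp cm : ℝ) (U : Set ℝ) (p : ℝ) : ℝ≥0∞ :=
  sInf {C : ℝ≥0∞ | ∀ f : SchwartzMap (ℝ × ℝ) ℝ,
    lpN (calH b cp cm U ⇑f) p ≤ C * eLpNorm ⇑f (eN p) volume}

/-- `θ_{p,ℓ}`. -/
def theta (p : ℝ) (l : ℕ) : ℝ :=
  if (l : ℝ) ≤ (p - 1)⁻¹ then (p - 1) ^ (3 - 10 / p) else (l : ℝ) ^ (7 * (2 / p - 1))

/-- `Σ_{ℓ≥1} θ_{p,ℓ} 𝒦_p(U, 2^{-ℓ})`, valued in `ℝ≥0∞`. -/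
def KpSum (U : Set ℝ) (p : ℝ) : ℝ≥0∞ :=
  ∑' l : ℕ, ENNReal.ofReal (theta p (l + 1) * Kp U ((2:ℝ) ^ (-((l : ℝ) + 1))) p)

theorem measurable_curve (b cp cm : ℝ) : Measurable (curve b cp cm) := by
  unfold curve
  refine Measurable.ite measurableSet_Ioi (by fun_prop) ?_
  exact Measurable.ite measurableSet_Iio (by fun_prop) measurable_const

theorem curve_of_pos {b cp cm t : ℝ} (ht : 0 < t) : curve b cp cm t = cp * t ^ b := by
  simp [curve, ht]

theorem curve_neg_of_pos {b cp cm t : ℝ} (ht : 0 < t) : curve b cp cm (-t) = cm * t ^ b := by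
  simp [curve, ht, ht.le, not_lt]

/-- Smooth compactly supported functions on the plane. -/
def IsTest (f : ℝ × ℝ → ℝ) : Prop := ContDiff ℝ ((⊤ : ℕ∞) : WithTop ℕ∞) f ∧ HasCompactSupport f

namespace IsTest

theorem zero : IsTest fun _ => 0 := ⟨contDiff_const, HasCompactSupport.zero⟩

theorem add {f g : ℝ × ℝ → ℝ} (hf : IsTest f) (hg : IsTest g) : IsTest fun x => f x + g x :=
  ⟨hf.1.add hg.1, hf.2.add hg.2⟩

theorem const_mul {f : ℝ × ℝ → ℝ} (hf : IsTest f) (c : ℝ) : IsTest fun x => c * f x :=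
  ⟨contDiff_const.mul hf.1, hf.2.mul_left⟩

theorem continuous {f : ℝ × ℝ → ℝ} (hf : IsTest f) : Continuous f := hf.1.continuous

theorem exists_bound {f : ℝ × ℝ → ℝ} (hf : IsTest f) : ∃ ρ : ℝ, 0 < ρ ∧ ∀ x, ρ ≤ ‖x‖ → f x = 0 := by
  obtain ⟨r, hr⟩ := hf.2.isCompact.isBounded.exists_norm_le
  refine ⟨max r 0 + 1, by positivity, fun x hx => ?_⟩
  by_contra h
  have := hr x (subset_tsupport f h)
  linarith [le_max_left r 0]

theorem exists_lipschitz {f : ℝ × ℝ → ℝ} (hf : IsTest f) :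
    ∃ L : ℝ, 0 ≤ L ∧ ∀ x y, |f x - f y| ≤ L * ‖x - y‖ := by
  obtain ⟨C, hC⟩ := ContDiff.lipschitzWith_of_hasCompactSupport hf.2 hf.1 (by simp)
  refine ⟨C, C.2, fun x y => ?_⟩
  simpa [Real.dist_eq, dist_eq_norm] using hC.dist_le_mul x y

end IsTest

/-- The kernel of the Hilbert transform along the curve, folded onto `t > 0`. -/
def foldedKernel (b cp cm u : ℝ) (f : ℝ × ℝ → ℝ) (x : ℝ × ℝ) (t : ℝ) : ℝ :=
  (f (x - (t, u * curve b cp cm t)) - f (x - (-t, u * curve b cp cm (-t)))) / t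

/-- The Hilbert transform along the curve as an absolutely convergent integral over `t > 0`. -/
def foldedHilbert (b cp cm u : ℝ) (f : ℝ × ℝ → ℝ) (x : ℝ × ℝ) : ℝ :=
  ∫ t in Ioi (0 : ℝ), foldedKernel b cp cm u f x t

theorem measurable_foldedKernel {b cp cm u : ℝ} {f : ℝ × ℝ → ℝ} (hf : IsTest f) :
    Measurable fun z : (ℝ × ℝ) × ℝ => foldedKernel b cp cm u f z.1 z.2 := by
  have hc := measurable_curve b cp cm
  have hm := hf.continuous.measurable
  unfold foldedKernel
  refine Measurable.div (Measurable.sub (hm.comp ?_) (hm.comp ?_)) measurable_snd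
  · exact measurable_fst.sub (measurable_snd.prodMk ((hc.comp measurable_snd).const_mul u))
  · exact measurable_fst.sub
      (measurable_snd.neg.prodMk ((hc.comp measurable_snd.neg).const_mul u))

theorem exists_foldedKernel_bound {b cp cm u : ℝ} (hb : 1 < b) {f : ℝ × ℝ → ℝ} (hf : IsTest f)
    (R : ℝ) : ∃ T M : ℝ, 0 ≤ M ∧ ∀ x : ℝ × ℝ, ‖x‖ ≤ R → ∀ t : ℝ, 0 < t →
      |foldedKernel b cp cm u f x t| ≤ (Ioc 0 T).indicator (fun _ => M) t := by
  obtain ⟨ρ, hρ, hfρ⟩ := hf.exists_bound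
  obtain ⟨L, hL, hfL⟩ := hf.exists_lipschitz
  set T : ℝ := |R| + ρ with hT
  have hT0 : 0 < T := by positivity
  refine ⟨T, L * (2 + |u| * ((|cp| + |cm|) * T ^ (b - 1))), by positivity, fun x hx t ht => ?_⟩
  have hxR : |x.1| ≤ |R| := by
    calc |x.1| = ‖x.1‖ := rfl
      _ ≤ ‖x‖ := norm_fst_le x
      _ ≤ |R| := hx.trans (le_abs_self R)
  by_cases htT : t ≤ T
  · rw [indicator_of_mem (show t ∈ Ioc 0 T from ⟨ht, htT⟩), foldedKernel, abs_div, abs_of_pos ht,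
      div_le_iff₀ ht]
    refine (hfL _ _).trans ?_
    rw [mul_assoc]
    refine mul_le_mul_of_nonneg_left ?_ hL
    have htb : t ^ b = t ^ (b - 1) * t := by
      rw [← Real.rpow_add_one ht.ne']; congr 1; ring
    have htT' : t ^ (b - 1) ≤ T ^ (b - 1) := Real.rpow_le_rpow ht.le htT (by linarith)
    have e : x - (t, u * curve b cp cm t) - (x - (-t, u * curve b cp cm (-t)))
        = (-(2 * t), u * ((cm - cp) * t ^ b)) := by
      rw [curve_of_pos ht, curve_neg_of_pos ht]
      ext <;> simp <;> ring
    rw [e, Prod.norm_def]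
    refine max_le ?_ ?_
    · simp only [norm_neg, Real.norm_eq_abs, abs_of_pos (show 0 < 2 * t by positivity)]
      have : 0 ≤ |u| * ((|cp| + |cm|) * T ^ (b - 1)) := by positivity
      nlinarith
    · simp only [Real.norm_eq_abs, abs_mul]
      rw [abs_of_nonneg (Real.rpow_nonneg ht.le b), htb]
      have h1 : |cm - cp| ≤ |cp| + |cm| := by
        rw [add_comm]; exact abs_sub cm cp
      calc |u| * (|cm - cp| * (t ^ (b - 1) * t))
          ≤ |u| * ((|cp| + |cm|) * (T ^ (b - 1) * t)) := by gcongr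
        _ ≤ (2 + |u| * ((|cp| + |cm|) * T ^ (b - 1))) * t := by nlinarith
  · rw [indicator_of_notMem (fun h => htT h.2)]
    push Not at htT
    have h1 : f (x - (t, u * curve b cp cm t)) = 0 := by
      refine hfρ _ (le_trans ?_ (norm_fst_le _))
      simp only [Prod.fst_sub, Real.norm_eq_abs]
      have := abs_sub_abs_le_abs_sub t x.1
      rw [abs_sub_comm, abs_of_pos ht] at this
      linarith
    have h2 : f (x - (-t, u * curve b cp cm (-t))) = 0 := by
      refine hfρ _ (le_trans ?_ (norm_fst_le _))
      simp only [Prod.fst_sub, Real.norm_eq_abs]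
      have := abs_sub_abs_le_abs_sub (-t) x.1
      rw [abs_sub_comm, abs_neg, abs_of_pos ht] at this
      linarith
    simp [foldedKernel, h1, h2]

theorem integrableOn_foldedKernel {b cp cm u : ℝ} (hb : 1 < b) {f : ℝ × ℝ → ℝ} (hf : IsTest f)
    (x : ℝ × ℝ) : IntegrableOn (foldedKernel b cp cm u f x) (Ioi 0) := by
  obtain ⟨T, M, hM, h⟩ := exists_foldedKernel_bound (cp := cp) (cm := cm) (u := u) hb hf ‖x‖
  refine Integrable.mono' (g := (Ioc 0 T).indicator fun _ => M) ?_
    ((measurable_foldedKernel hf).comp measurable_prodMk_left).aestronglyMeasurable ?_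
  · exact ((integrableOn_const (by simp)).integrable_indicator measurableSet_Ioc).integrableOn
  · exact (ae_restrict_mem measurableSet_Ioi).mono fun t ht => h x le_rfl t ht

theorem integrable_mul_foldedKernel {b cp cm u : ℝ} (hb : 1 < b) {f θ : ℝ × ℝ → ℝ}
    (hf : IsTest f) (hθ : Measurable θ) {B R : ℝ} (hθB : ∀ x, |θ x| ≤ B)
    (hθR : ∀ x, R < ‖x‖ → θ x = 0) :
    Integrable (fun z : (ℝ × ℝ) × ℝ => θ z.1 * foldedKernel b cp cm u f z.1 z.2)
      ((volume : Measure (ℝ × ℝ)).prod (volume.restrict (Ioi (0 : ℝ)))) := by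
  obtain ⟨T, M, hM, h⟩ := exists_foldedKernel_bound (cp := cp) (cm := cm) (u := u) hb hf R
  have hB : 0 ≤ B := (abs_nonneg _).trans (hθB 0)
  have hg : Integrable (fun z : (ℝ × ℝ) × ℝ =>
      (Metric.closedBall (0 : ℝ × ℝ) R).indicator (fun _ => B) z.1 *
        (Ioc 0 T).indicator (fun _ => M) z.2)
      ((volume : Measure (ℝ × ℝ)).prod (volume.restrict (Ioi (0 : ℝ)))) := by
    refine Integrable.mul_prod (f := (Metric.closedBall (0 : ℝ × ℝ) R).indicator fun _ => B)
      (g := (Ioc 0 T).indicator fun _ => M) ?_ ?_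
    · exact (integrableOn_const (measure_closedBall_lt_top.ne)).integrable_indicator
        Metric.isClosed_closedBall.measurableSet
    · exact ((integrableOn_const (by simp)).integrable_indicator measurableSet_Ioc).integrableOn
  refine hg.mono' ((hθ.comp measurable_fst).mul
    (measurable_foldedKernel hf)).aestronglyMeasurable ?_
  have hae : ∀ᵐ z : (ℝ × ℝ) × ℝ ∂((volume : Measure (ℝ × ℝ)).prod
      (volume.restrict (Ioi (0 : ℝ)))), z.2 ∈ Ioi (0 : ℝ) :=
    Measure.quasiMeasurePreserving_snd.ae (ae_restrict_mem measurableSet_Ioi)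
  refine hae.mono fun z hz => ?_
  rw [norm_mul, Real.norm_eq_abs, Real.norm_eq_abs]
  by_cases hzR : ‖z.1‖ ≤ R
  · rw [indicator_of_mem (by simpa using hzR)]
    exact mul_le_mul (hθB _) (h _ hzR _ hz) (abs_nonneg _) hB
  · rw [hθR _ (not_le.1 hzR), abs_zero, zero_mul]
    exact mul_nonneg (indicator_nonneg (fun _ _ => hB) _) (indicator_nonneg (fun _ _ => hM) _)

theorem integrable_mul_foldedHilbert {b cp cm u : ℝ} (hb : 1 < b) {f θ : ℝ × ℝ → ℝ}
    (hf : IsTest f) (hθ : Measurable θ) {B R : ℝ} (hθB : ∀ x, |θ x| ≤ B)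
    (hθR : ∀ x, R < ‖x‖ → θ x = 0) :
    Integrable fun x => θ x * foldedHilbert b cp cm u f x := by
  have := (integrable_mul_foldedKernel (cp := cp) (cm := cm) (u := u)
    hb hf hθ hθB hθR).integral_prod_left
  simp only [integral_const_mul] at this
  exact this

theorem integral_mul_foldedHilbert {b cp cm u : ℝ} (hb : 1 < b) {f θ : ℝ × ℝ → ℝ}
    (hf : IsTest f) (hθ : Measurable θ) {B R : ℝ} (hθB : ∀ x, |θ x| ≤ B)
    (hθR : ∀ x, R < ‖x‖ → θ x = 0) :
    ∫ x, θ x * foldedHilbert b cp cm u f x =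
      ∫ t in Ioi (0 : ℝ), ∫ x, θ x * foldedKernel b cp cm u f x t := by
  rw [← integral_integral_swap (f := fun x t => θ x * foldedKernel b cp cm u f x t)
    (integrable_mul_foldedKernel hb hf hθ hθB hθR)]
  simp only [integral_const_mul, foldedHilbert]

theorem foldedHilbert_add {b cp cm u : ℝ} (hb : 1 < b) {f g : ℝ × ℝ → ℝ} (hf : IsTest f)
    (hg : IsTest g) (x : ℝ × ℝ) :
    foldedHilbert b cp cm u (fun y => f y + g y) x =
      foldedHilbert b cp cm u f x + foldedHilbert b cp cm u g x := by
  unfold foldedHilbert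
  rw [← integral_add (integrableOn_foldedKernel hb hf x) (integrableOn_foldedKernel hb hg x)]
  congr 1; ext t
  simp only [foldedKernel]
  ring

theorem foldedHilbert_const_mul {b cp cm u : ℝ} (c : ℝ) (f : ℝ × ℝ → ℝ) (x : ℝ × ℝ) :
    foldedHilbert b cp cm u (fun y => c * f y) x = c * foldedHilbert b cp cm u f x := by
  unfold foldedHilbert
  rw [← integral_const_mul]
  congr 1; ext t
  simp only [foldedKernel]
  ring

theorem foldedHilbert_zero {b cp cm u : ℝ} (x : ℝ × ℝ) :
    foldedHilbert b cp cm u (fun _ => 0) x = 0 := by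
  simp [foldedHilbert, foldedKernel]

theorem foldedHilbert_sum {b cp cm u : ℝ} (hb : 1 < b) {ι : Type} (s : Finset ι) (w : ι → ℝ)
    {f : ι → ℝ × ℝ → ℝ} (hf : ∀ i, IsTest (f i)) (x : ℝ × ℝ) :
    IsTest (fun y => ∑ i ∈ s, w i * f i y) ∧
    foldedHilbert b cp cm u (fun y => ∑ i ∈ s, w i * f i y) x =
      ∑ i ∈ s, w i * foldedHilbert b cp cm u (f i) x := by
  induction s using Finset.induction_on with
  | empty => simpa using ⟨IsTest.zero, foldedHilbert_zero x⟩
  | insert a s ha ih =>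
    simp only [Finset.sum_insert ha]
    refine ⟨((hf a).const_mul _).add ih.1, ?_⟩
    rw [foldedHilbert_add hb ((hf a).const_mul _) ih.1, ih.2, foldedHilbert_const_mul]

theorem Hu_eq_foldedHilbert {b cp cm u : ℝ} (hb : 1 < b) {f : ℝ × ℝ → ℝ} (hf : IsTest f)
    (x : ℝ × ℝ) : Hu b cp cm u f x = foldedHilbert b cp cm u f x := by
  have hint := integrableOn_foldedKernel (cp := cp) (cm := cm) (u := u) hb hf x
  set F : ℝ → ℝ := fun t => f (x - (t, u * curve b cp cm t)) / t with hF
  have hFm : Measurable F :=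
    (hf.continuous.measurable.comp (measurable_const.sub
      (measurable_id.prodMk ((measurable_curve b cp cm).const_mul u)))).div measurable_id
  obtain ⟨M, hM⟩ := hf.2.exists_bound_of_continuous hf.continuous
  have hM0 : 0 ≤ M := (norm_nonneg _).trans (hM 0)
  have hFint : ∀ ε : ℝ, 0 < ε → ∀ s : Set ℝ, MeasurableSet s → volume s < ⊤ →
      (∀ t ∈ s, ε < |t|) → IntegrableOn F s := by
    intro ε hε s hs hvs hst
    refine IntegrableOn.of_bound hvs hFm.aestronglyMeasurable (M / ε) ?_
    refine (ae_restrict_mem hs).mono fun t ht => ?_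
    rw [norm_div]
    exact div_le_div₀ hM0 (hM _) hε (hst t ht).le
  have key : ∀ ε : ℝ, 0 < ε → ∫ t in {t : ℝ | ε < |t| ∧ |t| < ε⁻¹}, F t =
      ∫ t in Ioi (0 : ℝ), (Ioo ε ε⁻¹).indicator (foldedKernel b cp cm u f x) t := by
    intro ε hε
    have hset : {t : ℝ | ε < |t| ∧ |t| < ε⁻¹} = Ioo ε ε⁻¹ ∪ Ioo (-ε⁻¹) (-ε) := by
      ext t
      simp only [mem_ofPred_eq, mem_union, mem_Ioo]
      rcases le_total 0 t with h | h
      · rw [abs_of_nonneg h]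
        constructor
        · exact Or.inl
        · rintro (h' | h')
          · exact h'
          · linarith
      · rw [abs_of_nonpos h]
        constructor
        · intro h'; right; constructor <;> linarith
        · rintro (h' | h')
          · linarith
          · constructor <;> linarith
    have i1 : IntegrableOn F (Ioo ε ε⁻¹) := hFint ε hε _ measurableSet_Ioo (by simp)
      fun t ht => ht.1.trans_le (le_abs_self t)
    have i2 : IntegrableOn F (Ioo (-ε⁻¹) (-ε)) := hFint ε hε _ measurableSet_Ioo (by simp)
      fun t ht => by have := neg_le_abs t; linarith [ht.2]
    rw [hset, setIntegral_union _ measurableSet_Ioo i1 i2]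
    · have hneg : ∫ t in Ioo (-ε⁻¹) (-ε), F t = ∫ t in Ioo ε ε⁻¹, F (-t) := by
        rw [← integral_indicator measurableSet_Ioo, ← integral_indicator measurableSet_Ioo,
          ← integral_neg_eq_self]
        congr 1; ext t
        simp only [indicator, mem_Ioo]
        congr 1
        simp only [eq_iff_iff]
        constructor <;> rintro ⟨h1, h2⟩ <;> constructor <;> linarith
      have i3 : IntegrableOn (fun t => F (-t)) (Ioo ε ε⁻¹) := by
        refine IntegrableOn.of_bound (by simp)
          (hFm.comp measurable_neg).aestronglyMeasurable (M / ε) ?_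
        refine (ae_restrict_mem measurableSet_Ioo).mono fun t ht => ?_
        simp only [hF]
        rw [norm_div, norm_neg]
        exact div_le_div₀ hM0 (hM _) hε (ht.1.le.trans (le_abs_self t))
      rw [hneg, ← integral_add i1 i3, setIntegral_indicator measurableSet_Ioo]
      have : Ioi (0 : ℝ) ∩ Ioo ε ε⁻¹ = Ioo ε ε⁻¹ :=
        inter_eq_right.2 fun t ht => hε.trans ht.1
      rw [this]
      congr 1; ext t
      simp only [hF, foldedKernel, div_neg]
      ring
    · rw [disjoint_left]
      rintro t ⟨h1, h2⟩ ⟨h3, h4⟩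
      linarith
  unfold Hu
  refine Tendsto.limUnder_eq ?_
  have hlim : Tendsto (fun ε : ℝ => ∫ t in Ioi (0 : ℝ),
      (Ioo ε ε⁻¹).indicator (foldedKernel b cp cm u f x) t) (𝓝[>] 0)
      (𝓝 (foldedHilbert b cp cm u f x)) := by
    refine tendsto_integral_filter_of_dominated_convergence
      (fun t => ‖foldedKernel b cp cm u f x t‖) ?_ ?_ hint.norm ?_
    · refine Eventually.of_forall fun ε => ?_
      exact (((measurable_foldedKernel hf).comp measurable_prodMk_left).indicator
        measurableSet_Ioo).aestronglyMeasurable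
    · exact Eventually.of_forall fun ε => Eventually.of_forall fun t =>
        norm_indicator_le_norm_self _ _
    · refine (ae_restrict_mem measurableSet_Ioi).mono fun t ht => ?_
      have h1 : ∀ᶠ ε in 𝓝[>] (0 : ℝ), ε < t :=
        nhdsWithin_le_nhds (Iio_mem_nhds ht)
      have h2 : ∀ᶠ ε in 𝓝[>] (0 : ℝ), t < ε⁻¹ := tendsto_inv_nhdsGT_zero.eventually_gt_atTop t
      refine tendsto_const_nhds.congr' ?_
      filter_upwards [h1, h2] with ε h1 h2
      rw [indicator_of_mem (show t ∈ Ioo ε ε⁻¹ from ⟨h1, h2⟩)]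
  refine hlim.congr' ?_
  filter_upwards [self_mem_nhdsWithin] with ε hε
  exact (key ε hε).symm

/-- A smooth bump on the line, supported in `[1/4, 3/4]` and symmetric about `1/2`. -/
def profile : ContDiffBump (1 / 2 : ℝ) := ⟨1 / 8, 1 / 4, by norm_num, by norm_num⟩

theorem profile_one_sub (x : ℝ) : profile (1 - x) = profile x := by
  have := profile.sub (x - 1 / 2)
  rw [show (1 / 2 : ℝ) - (x - 1 / 2) = 1 - x by ring,
    show (1 / 2 : ℝ) + (x - 1 / 2) = x by ring] at this
  exact this

theorem profile_eq_zero_of_le {x : ℝ} (hx : x ≤ 1 / 4) : profile x = 0 := by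
  refine profile.zero_of_le_dist ?_
  rw [Real.dist_eq, abs_of_nonpos (by linarith)]
  change (1 / 4 : ℝ) ≤ _
  linarith

theorem profile_eq_zero_of_ge {x : ℝ} (hx : 3 / 4 ≤ x) : profile x = 0 := by
  rw [← profile_one_sub]
  exact profile_eq_zero_of_le (by linarith)

theorem profile_eq_one {x : ℝ} (h1 : 3 / 8 ≤ x) (h2 : x ≤ 5 / 8) : profile x = 1 := by
  refine profile.one_of_mem_closedBall ?_
  rw [Metric.mem_closedBall, Real.dist_eq]
  change _ ≤ (1 / 8 : ℝ)
  rw [abs_le]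
  constructor <;> linarith

/-- Correlation of `profile` with the sign function of `x - 1/2` on `[0,1]`. -/
def signCorr (τ : ℝ) : ℝ :=
  (∫ x in (1 / 2 : ℝ)..1, profile (x - τ)) - ∫ x in (0 : ℝ)..(1 / 2), profile (x - τ)

/-- Correlation of `profile` with the indicator function of `[0,1]`. -/
def unitCorr (ζ : ℝ) : ℝ := ∫ x in (0 : ℝ)..1, profile (x - ζ)

theorem intervalIntegrable_profile (τ a b : ℝ) :
    IntervalIntegrable (fun x => profile (x - τ)) volume a b :=
  (profile.continuous.comp (continuous_id.sub continuous_const)).intervalIntegrable a b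

theorem continuous_integral_profile (a b : ℝ) :
    Continuous fun τ : ℝ => ∫ x in a..b, profile (x - τ) := by
  refine intervalIntegral.continuous_parametric_intervalIntegral_of_continuous' ?_ a b
  exact profile.continuous.comp (continuous_snd.sub continuous_fst)

theorem continuous_signCorr : Continuous signCorr :=
  (continuous_integral_profile _ _).sub (continuous_integral_profile _ _)

theorem continuous_unitCorr : Continuous unitCorr := continuous_integral_profile _ _

theorem signCorr_neg (τ : ℝ) : signCorr (-τ) = -signCorr τ := by
  have h : ∀ a b : ℝ, ∫ x in a..b, profile (x - -τ) = ∫ x in (1 - b)..(1 - a), profile (x - τ) := by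
    intro a b
    rw [← intervalIntegral.integral_comp_sub_left (fun x => profile (x - τ)) 1]
    congr 1; ext x
    rw [← profile_one_sub]
    congr 1; ring
  unfold signCorr
  rw [h, h]
  norm_num

theorem signCorr_eq_zero {τ : ℝ} (hτ : 1 ≤ τ) : signCorr τ = 0 := by
  have h : ∀ a b : ℝ, a ≤ b → b ≤ 1 → ∫ x in a..b, profile (x - τ) = 0 := by
    intro a b hab hb
    refine intervalIntegral.integral_zero_ae (Eventually.of_forall fun x hx => ?_)
    rw [uIoc_of_le hab] at hx
    exact profile_eq_zero_of_le (by linarith [hx.2])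
  rw [signCorr, h (1 / 2) 1 (by norm_num) le_rfl, h 0 (1 / 2) (by norm_num) (by norm_num), sub_zero]

theorem integral_profile_nonneg {a b τ : ℝ} (hab : a ≤ b) :
    0 ≤ ∫ x in a..b, profile (x - τ) :=
  intervalIntegral.integral_nonneg hab fun _ _ => profile.nonneg

theorem integral_profile_le {a b τ : ℝ} (hab : a ≤ b) :
    ∫ x in a..b, profile (x - τ) ≤ b - a := by
  have := intervalIntegral.integral_mono_on hab (intervalIntegrable_profile τ a b)
    (intervalIntegrable_const (c := (1 : ℝ))) fun _ _ => profile.le_one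
  simpa using this

theorem signCorr_eq_of_le {τ : ℝ} (h0 : 0 ≤ τ) (h1 : τ ≤ 1 / 4) :
    signCorr τ = 2 * ∫ x in (1 / 2 : ℝ)..(1 / 2 + τ), profile (x - τ) := by
  have hz : ∀ a b : ℝ, (∀ x ∈ uIoc a b, profile (x - τ) = 0) →
      ∫ x in a..b, profile (x - τ) = 0 := fun a b h =>
    intervalIntegral.integral_zero_ae (Eventually.of_forall h)
  have e1 : ∫ x in (1 / 2 : ℝ)..1, profile (x - τ) =
      (∫ x in (1 / 2 : ℝ)..(1 / 2 + τ), profile (x - τ)) +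
        ∫ x in (1 / 2 + τ)..(1 + τ), profile (x - τ) := by
    rw [intervalIntegral.integral_add_adjacent_intervals (intervalIntegrable_profile _ _ _)
      (intervalIntegrable_profile _ _ _), ← intervalIntegral.integral_add_adjacent_intervals
      (intervalIntegrable_profile τ (1 / 2) 1) (intervalIntegrable_profile τ 1 (1 + τ)),
      hz 1 (1 + τ), add_zero]
    intro x hx
    rw [uIoc_of_le (by linarith)] at hx
    exact profile_eq_zero_of_ge (by linarith [hx.1])
  have e2 : (∫ x in (0 : ℝ)..(1 / 2), profile (x - τ)) +
      (∫ x in (1 / 2 : ℝ)..(1 / 2 + τ), profile (x - τ)) =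
        ∫ x in τ..(1 / 2 + τ), profile (x - τ) := by
    rw [intervalIntegral.integral_add_adjacent_intervals (intervalIntegrable_profile _ _ _)
      (intervalIntegrable_profile _ _ _), ← intervalIntegral.integral_add_adjacent_intervals
      (intervalIntegrable_profile τ 0 τ) (intervalIntegrable_profile τ τ (1 / 2 + τ)),
      hz 0 τ, zero_add]
    intro x hx
    rw [uIoc_of_le h0] at hx
    exact profile_eq_zero_of_le (by linarith [hx.2])
  have e3 : ∫ x in (1 / 2 + τ)..(1 + τ), profile (x - τ) =
      ∫ x in τ..(1 / 2 + τ), profile (x - τ) := by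
    rw [intervalIntegral.integral_comp_sub_right (fun x => profile x),
      intervalIntegral.integral_comp_sub_right (fun x => profile x)]
    have := intervalIntegral.integral_comp_sub_left (fun x => profile x) (1 : ℝ)
      (a := 1 / 2) (b := 1)
    simp only [profile_one_sub] at this
    rw [show 1 / 2 + τ - τ = (1 / 2 : ℝ) by ring, show 1 + τ - τ = (1 : ℝ) by ring, this]
    norm_num
  unfold signCorr
  linarith

theorem signCorr_bounds {τ : ℝ} (h0 : 0 ≤ τ) : 0 ≤ signCorr τ ∧ signCorr τ ≤ 2 * τ := by
  rcases le_total τ (1 / 4) with h1 | h1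
  · rw [signCorr_eq_of_le h0 h1]
    have h2 := integral_profile_nonneg (a := 1 / 2) (b := 1 / 2 + τ) (τ := τ) (by linarith)
    have h3 := integral_profile_le (a := 1 / 2) (b := 1 / 2 + τ) (τ := τ) (by linarith)
    constructor <;> linarith
  · have hz : ∫ x in (0 : ℝ)..(1 / 2), profile (x - τ) = 0 := by
      refine intervalIntegral.integral_zero_ae (Eventually.of_forall fun x hx => ?_)
      rw [uIoc_of_le (by norm_num)] at hx
      exact profile_eq_zero_of_le (by linarith [hx.2])
    have h2 := integral_profile_nonneg (a := 1 / 2) (b := 1) (τ := τ) (by norm_num)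
    have h3 := integral_profile_le (a := 1 / 2) (b := 1) (τ := τ) (by norm_num)
    unfold signCorr
    rw [hz]
    constructor <;> linarith

theorem integral_profile_ge {a b τ : ℝ} (h1 : a ≤ 3 / 8 + τ) (h2 : 5 / 8 + τ ≤ b) :
    1 / 4 ≤ ∫ x in a..b, profile (x - τ) := by
  have e : ∫ x in a..b, profile (x - τ) = (∫ x in a..(3 / 8 + τ), profile (x - τ)) +
      (∫ x in (3 / 8 + τ)..(5 / 8 + τ), profile (x - τ)) +
      ∫ x in (5 / 8 + τ)..b, profile (x - τ) := by
    rw [intervalIntegral.integral_add_adjacent_intervals (intervalIntegrable_profile _ _ _)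
      (intervalIntegrable_profile _ _ _), intervalIntegral.integral_add_adjacent_intervals
      (intervalIntegrable_profile _ _ _) (intervalIntegrable_profile _ _ _)]
  have hm : ∫ x in (3 / 8 + τ)..(5 / 8 + τ), profile (x - τ) = 1 / 4 := by
    rw [intervalIntegral.integral_congr (g := fun _ => (1 : ℝ))]
    · simp; ring
    · intro x hx
      rw [uIcc_of_le (by linarith)] at hx
      exact profile_eq_one (by linarith [hx.1]) (by linarith [hx.2])
  linarith [integral_profile_nonneg (τ := τ) h1, integral_profile_nonneg (τ := τ) h2]

theorem signCorr_ge {τ : ℝ} (h1 : 1 / 4 ≤ τ) (h2 : τ ≤ 3 / 8) : 1 / 4 ≤ signCorr τ := by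
  have hz : ∫ x in (0 : ℝ)..(1 / 2), profile (x - τ) = 0 := by
    refine intervalIntegral.integral_zero_ae (Eventually.of_forall fun x hx => ?_)
    rw [uIoc_of_le (by norm_num)] at hx
    exact profile_eq_zero_of_le (by linarith [hx.2])
  have := integral_profile_ge (a := 1 / 2) (b := 1) (τ := τ) (by linarith) (by linarith)
  unfold signCorr
  linarith

theorem unitCorr_nonneg (ζ : ℝ) : 0 ≤ unitCorr ζ := integral_profile_nonneg (by norm_num)

theorem unitCorr_le_one (ζ : ℝ) : unitCorr ζ ≤ 1 :=
  (integral_profile_le (by norm_num)).trans (by norm_num)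

theorem unitCorr_ge {ζ : ℝ} (h : |ζ| ≤ 1 / 4) : 1 / 4 ≤ unitCorr ζ := by
  rw [abs_le] at h
  exact integral_profile_ge (by linarith) (by linarith)

theorem unitCorr_eq_zero {ζ : ℝ} (h : 1 ≤ |ζ|) : unitCorr ζ = 0 := by
  refine intervalIntegral.integral_zero_ae (Eventually.of_forall fun x hx => ?_)
  rw [uIoc_of_le (by norm_num)] at hx
  rcases le_abs.1 h with h | h
  · exact profile_eq_zero_of_le (by linarith [hx.2])
  · exact profile_eq_zero_of_ge (by linarith [hx.1])

/-- The normalized interaction of a half-cell sign function with a bump under the Hilbert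
transform along the curve. -/
def interaction (b cp cm v : ℝ) : ℝ :=
  ∫ τ in Ioi (0 : ℝ),
    signCorr τ / τ * (unitCorr (v * (cp * τ ^ b)) + unitCorr (v * (cm * τ ^ b)))

theorem exists_interaction_gap {b cp cm : ℝ} (hb : 1 < b) (hcp : cp ≠ 0) (hcm : cm ≠ 0) :
    ∃ K : ℝ, 1 ≤ K ∧ ∀ v : ℝ, 0 < v → (v * K ≤ 1 → 1 / 64 ≤ interaction b cp cm v) ∧
      (K ≤ v → interaction b cp cm v ≤ 1 / 128) := by
  have hp : 0 < |cp| := abs_pos.2 hcp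
  have hm : 0 < |cm| := abs_pos.2 hcm
  have h512 : (0 : ℝ) < (1 / 512 : ℝ) ^ b := by positivity
  set K : ℝ := 1 + 4 * (|cp| + |cm|) + (1 / |cp| + 1 / |cm|) / (1 / 512 : ℝ) ^ b with hK
  refine ⟨K, ?_, fun v hv => ?_⟩
  · have : 0 ≤ (1 / |cp| + 1 / |cm|) / (1 / 512 : ℝ) ^ b := by positivity
    linarith
  have hD : ∀ τ : ℝ, 0 < τ → 0 ≤ signCorr τ / τ ∧ signCorr τ / τ ≤ 2 := fun τ hτ => by
    have := signCorr_bounds hτ.le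
    exact ⟨div_nonneg this.1 hτ.le, (div_le_iff₀ hτ).2 this.2⟩
  have hU : ∀ τ : ℝ, 0 ≤ unitCorr (v * (cp * τ ^ b)) + unitCorr (v * (cm * τ ^ b)) ∧
      unitCorr (v * (cp * τ ^ b)) + unitCorr (v * (cm * τ ^ b)) ≤ 2 := fun τ =>
    ⟨add_nonneg (unitCorr_nonneg _) (unitCorr_nonneg _), by
      linarith [unitCorr_le_one (v * (cp * τ ^ b)), unitCorr_le_one (v * (cm * τ ^ b))]⟩
  have habs : ∀ c τ : ℝ, 0 < τ → |v * (c * τ ^ b)| = v * |c| * τ ^ b := fun c τ hτ => by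
    rw [abs_mul, abs_mul, abs_of_pos hv, abs_of_pos (Real.rpow_pos_of_pos hτ b)]; ring
  have hint : IntegrableOn (fun τ => signCorr τ / τ *
      (unitCorr (v * (cp * τ ^ b)) + unitCorr (v * (cm * τ ^ b)))) (Ioi 0) := by
    refine Integrable.mono' (g := (Ioc 0 1).indicator fun _ => (4 : ℝ)) ?_ ?_ ?_
    · exact ((integrableOn_const (by simp)).integrable_indicator measurableSet_Ioc).integrableOn
    · refine Measurable.aestronglyMeasurable ?_
      have h1 := continuous_signCorr.measurable
      have h2 := continuous_unitCorr.measurable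
      fun_prop
    · refine (ae_restrict_mem measurableSet_Ioi).mono fun τ hτ => ?_
      have hτ' : 0 < τ := hτ
      rw [Real.norm_eq_abs, abs_of_nonneg (mul_nonneg (hD τ hτ').1 (hU τ).1)]
      by_cases h1 : τ ≤ 1
      · rw [indicator_of_mem (show τ ∈ Ioc 0 1 from ⟨hτ', h1⟩)]
        calc _ ≤ (2 : ℝ) * 2 := mul_le_mul (hD τ hτ').2 (hU τ).2 (hU τ).1 (by norm_num)
          _ = 4 := by norm_num
      · rw [signCorr_eq_zero (not_le.1 h1).le]
        simp only [zero_div, zero_mul]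
        exact indicator_nonneg (fun _ _ => by norm_num) _
  constructor
  · intro hvK
    have hlow : ∫ τ in Ioi (0 : ℝ), (Ioc (1 / 4 : ℝ) (3 / 8)).indicator (fun _ => (1 / 8 : ℝ)) τ =
        1 / 64 := by
      rw [setIntegral_indicator measurableSet_Ioc,
        inter_eq_right.2 (Ioc_subset_Ioi_self.trans (Ioi_subset_Ioi (by norm_num)))]
      simp
      norm_num
    rw [← hlow]
    refine setIntegral_mono_on ?_ hint measurableSet_Ioi fun τ hτ => ?_
    · exact ((integrableOn_const (by simp)).integrable_indicator measurableSet_Ioc).integrableOn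
    have hτ' : 0 < τ := hτ
    by_cases h : τ ∈ Ioc (1 / 4 : ℝ) (3 / 8)
    · rw [indicator_of_mem h]
      have h1 : 1 / 4 ≤ signCorr τ / τ := by
        rw [le_div_iff₀ hτ']
        linarith [signCorr_ge h.1.le h.2, h.2]
      have h2 : ∀ c : ℝ, |c| ≤ |cp| + |cm| → 1 / 4 ≤ unitCorr (v * (c * τ ^ b)) := by
        intro c hc
        refine unitCorr_ge ?_
        rw [habs c τ hτ']
        have h3 : τ ^ b ≤ 1 := Real.rpow_le_one hτ'.le (by linarith [h.2]) (by linarith)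
        have h4 : v * (4 * (|cp| + |cm|)) ≤ 1 := by
          refine le_trans (mul_le_mul_of_nonneg_left ?_ hv.le) hvK
          have : 0 ≤ (1 / |cp| + 1 / |cm|) / (1 / 512 : ℝ) ^ b := by positivity
          linarith
        calc v * |c| * τ ^ b ≤ v * (|cp| + |cm|) * 1 := by gcongr
          _ ≤ 1 / 4 := by linarith
      have h5 := h2 cp (by linarith)
      have h6 := h2 cm (by linarith)
      nlinarith
    · rw [indicator_of_notMem h]
      exact mul_nonneg (hD τ hτ').1 (hU τ).1
  · intro hKv
    have hup : ∫ τ in Ioi (0 : ℝ), (Ioc (0 : ℝ) (1 / 512)).indicator (fun _ => (4 : ℝ)) τ =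
        1 / 128 := by
      rw [setIntegral_indicator measurableSet_Ioc, inter_eq_right.2 Ioc_subset_Ioi_self]
      simp
      norm_num
    rw [← hup]
    refine setIntegral_mono_on hint ?_ measurableSet_Ioi fun τ hτ => ?_
    · exact ((integrableOn_const (by simp)).integrable_indicator measurableSet_Ioc).integrableOn
    have hτ' : 0 < τ := hτ
    by_cases h : τ ∈ Ioc (0 : ℝ) (1 / 512)
    · rw [indicator_of_mem h]
      calc _ ≤ (2 : ℝ) * 2 := mul_le_mul (hD τ hτ').2 (hU τ).2 (hU τ).1 (by norm_num)
        _ = 4 := by norm_num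
    · rw [indicator_of_notMem h]
      have h1 : 1 / 512 < τ := by
        by_contra h'
        exact h ⟨hτ', not_lt.1 h'⟩
      have h2 : ∀ c : ℝ, 0 < |c| → 1 / |c| ≤ 1 / |cp| + 1 / |cm| →
          unitCorr (v * (c * τ ^ b)) = 0 := by
        intro c hc0 hc
        refine unitCorr_eq_zero ?_
        rw [habs c τ hτ']
        have h3 : (1 / 512 : ℝ) ^ b ≤ τ ^ b :=
          Real.rpow_le_rpow (by norm_num) h1.le (by linarith)
        have h4 : 1 / |c| / (1 / 512 : ℝ) ^ b ≤ v := by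
          refine le_trans ?_ hKv
          have : 1 / |c| / (1 / 512 : ℝ) ^ b ≤ (1 / |cp| + 1 / |cm|) / (1 / 512 : ℝ) ^ b := by
            gcongr
          linarith
        have h5 : 1 ≤ v * |c| * (1 / 512 : ℝ) ^ b := by
          rw [div_div, div_le_iff₀ (by positivity)] at h4
          linarith
        exact h5.trans (by gcongr)
      rw [h2 cp hp (by linarith [one_div_pos.2 hm]), h2 cm hm (by linarith [one_div_pos.2 hp])]
      simp

/-- The half-open rectangle with lower left corner `(a, c)`, width `w` and height `h`. -/
def cell (a w c h : ℝ) : Set (ℝ × ℝ) := Ico a (a + w) ×ˢ Ico c (c + h)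

theorem measurableSet_cell (a w c h : ℝ) : MeasurableSet (cell a w c h) :=
  measurableSet_Ico.prod measurableSet_Ico

theorem exists_cell_bound (a w c h : ℝ) : ∃ R : ℝ, ∀ x ∈ cell a w c h, ‖x‖ ≤ R :=
  (Metric.isBounded_Ico a (a + w)).prod (Metric.isBounded_Ico c (c + h)) |>.exists_norm_le

/-- The smooth bump adapted to a cell. -/
def cellBump (a w c h : ℝ) (x : ℝ × ℝ) : ℝ := profile ((x.1 - a) / w) * profile ((x.2 - c) / h)

/-- The function equal to `1` on the right half and `-1` on the left half of a cell. -/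
def halfSign (a w c h : ℝ) (x : ℝ × ℝ) : ℝ :=
  (cell (a + w / 2) (w / 2) c h).indicator 1 x - (cell a (w / 2) c h).indicator 1 x

theorem cellBump_support {a w c h : ℝ} (hw : 0 < w) (hh : 0 < h) :
    Function.support (cellBump a w c h) ⊆
      Icc (a + w / 4) (a + 3 * w / 4) ×ˢ Icc (c + h / 4) (c + 3 * h / 4) := by
  intro x hx
  have h1 : profile ((x.1 - a) / w) ≠ 0 := left_ne_zero_of_mul hx
  have h2 : profile ((x.2 - c) / h) ≠ 0 := right_ne_zero_of_mul hx
  have key : ∀ y a w : ℝ, 0 < w → profile ((y - a) / w) ≠ 0 →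
      y ∈ Icc (a + w / 4) (a + 3 * w / 4) := by
    intro y a w hw hy
    constructor
    · by_contra h'
      refine hy (profile_eq_zero_of_le ?_)
      rw [div_le_iff₀ hw]
      linarith
    · by_contra h'
      refine hy (profile_eq_zero_of_ge ?_)
      rw [le_div_iff₀ hw]
      linarith
  exact ⟨key _ _ _ hw h1, key _ _ _ hh h2⟩

theorem isTest_cellBump {a w c h : ℝ} (hw : 0 < w) (hh : 0 < h) : IsTest (cellBump a w c h) := by
  constructor
  · unfold cellBump
    exact (profile.contDiff.comp (by fun_prop)).mul (profile.contDiff.comp (by fun_prop))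
  · exact HasCompactSupport.of_support_subset_isCompact (isCompact_Icc.prod isCompact_Icc)
      (cellBump_support hw hh)

theorem cellBump_support_subset_cell {a w c h : ℝ} (hw : 0 < w) (hh : 0 < h) :
    Function.support (cellBump a w c h) ⊆ cell a w c h := by
  intro x hx
  obtain ⟨⟨h1, h2⟩, h3, h4⟩ := cellBump_support hw hh hx
  exact ⟨⟨by linarith, by linarith⟩, by linarith, by linarith⟩

theorem abs_cellBump_le_one (a w c h : ℝ) (x : ℝ × ℝ) : |cellBump a w c h x| ≤ 1 := by
  unfold cellBump
  rw [abs_mul, abs_of_nonneg profile.nonneg, abs_of_nonneg profile.nonneg]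
  exact mul_le_one₀ profile.le_one profile.nonneg profile.le_one

theorem measurable_halfSign (a w c h : ℝ) : Measurable (halfSign a w c h) :=
  (measurable_one.indicator (measurableSet_cell _ _ _ _)).sub
    (measurable_one.indicator (measurableSet_cell _ _ _ _))

theorem cell_halves_union {a w c h : ℝ} (hw : 0 ≤ w) :
    cell a (w / 2) c h ∪ cell (a + w / 2) (w / 2) c h = cell a w c h := by
  unfold cell
  rw [← union_prod, Ico_union_Ico_eq_Ico (by linarith) (by linarith)]
  congr 2; ring

theorem cell_halves_disjoint {a w c h : ℝ} :
    Disjoint (cell a (w / 2) c h) (cell (a + w / 2) (w / 2) c h) := by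
  rw [disjoint_left]
  rintro x ⟨h1, -⟩ ⟨h2, -⟩
  exact absurd h1.2 (not_lt.2 h2.1)

theorem abs_halfSign_le_one (a w c h : ℝ) (x : ℝ × ℝ) : |halfSign a w c h x| ≤ 1 := by
  unfold halfSign
  simp only [indicator, Pi.one_apply]
  split_ifs <;> simp

theorem halfSign_eq_zero {a w c h : ℝ} (hw : 0 ≤ w) {x : ℝ × ℝ} (hx : x ∉ cell a w c h) :
    halfSign a w c h x = 0 := by
  rw [← cell_halves_union hw, mem_union, not_or] at hx
  simp [halfSign, hx.1, hx.2]

theorem integral_profile_rescale {w : ℝ} (hw : w ≠ 0) (a t α β : ℝ) :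
    ∫ x in (w * α + a)..(w * β + a), profile ((x - t - a) / w) =
      w * ∫ y in α..β, profile (y - t / w) := by
  rw [← intervalIntegral.smul_integral_comp_mul_add (fun x => profile ((x - t - a) / w)) w a,
    smul_eq_mul]
  congr 2; ext y
  congr 1
  field_simp
  ring

theorem integral_indicator_Ico_mul {α β : ℝ} (h : α ≤ β) (g : ℝ → ℝ) :
    ∫ x, (Ico α β).indicator 1 x * g x = ∫ x in α..β, g x := by
  rw [intervalIntegral.integral_of_le h, ← integral_Ico_eq_integral_Ioc,
    ← integral_indicator measurableSet_Ico]
  congr 1; ext x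
  by_cases hx : x ∈ Ico α β <;> simp [hx]

theorem integral_halfSign_mul_cellBump {a w c h : ℝ} (hw : 0 < w) (hh : 0 < h) (t z : ℝ) :
    ∫ x, halfSign a w c h x * cellBump a w c h (x - (t, z)) =
      w * signCorr (t / w) * (h * unitCorr (z / h)) := by
  have hcont : ∀ t a w : ℝ, Continuous fun x : ℝ => profile ((x - t - a) / w) := fun t a w =>
    profile.continuous.comp (by fun_prop)
  have e : ∀ x : ℝ × ℝ, halfSign a w c h x * cellBump a w c h (x - (t, z)) =
      (((Ico (a + w / 2) (a + w)).indicator 1 x.1 - (Ico a (a + w / 2)).indicator 1 x.1) *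
        profile ((x.1 - t - a) / w)) *
      ((Ico c (c + h)).indicator 1 x.2 * profile ((x.2 - z - c) / h)) := by
    intro x
    have h1 : ∀ a' w' : ℝ, (cell a' w' c h).indicator (1 : ℝ × ℝ → ℝ) x =
        (Ico a' (a' + w')).indicator 1 x.1 * (Ico c (c + h)).indicator 1 x.2 := by
      intro a' w'
      simp only [indicator, cell, mem_prod, Pi.one_apply]
      split_ifs <;> simp_all
    simp only [halfSign, h1, cellBump, Prod.fst_sub, Prod.snd_sub]
    rw [show a + w / 2 + w / 2 = a + w by ring]
    ring
  simp only [e]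
  rw [Measure.volume_eq_prod, integral_prod_mul (fun x : ℝ =>
    ((Ico (a + w / 2) (a + w)).indicator 1 x - (Ico a (a + w / 2)).indicator 1 x) *
        profile ((x - t - a) / w)) (fun x : ℝ =>
    (Ico c (c + h)).indicator 1 x * profile ((x - z - c) / h))]
  congr 1
  · simp only [sub_mul]
    have hi : ∀ α β : ℝ, Integrable fun x : ℝ =>
        (Ico α β).indicator 1 x * profile ((x - t - a) / w) := by
      intro α β
      have : (fun x : ℝ => (Ico α β).indicator 1 x * profile ((x - t - a) / w)) =
          (Ico α β).indicator fun x => profile ((x - t - a) / w) := by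
        ext x
        by_cases hx : x ∈ Ico α β <;> simp [hx]
      rw [this, integrable_indicator_iff measurableSet_Ico]
      exact (hcont t a w).integrableOn_Icc.mono_set Ico_subset_Icc_self
    rw [integral_sub (hi _ _) (hi _ _), integral_indicator_Ico_mul (by linarith),
      integral_indicator_Ico_mul (by linarith)]
    have h1 := integral_profile_rescale hw.ne' a t (1 / 2) 1
    have h2 := integral_profile_rescale hw.ne' a t 0 (1 / 2)
    rw [show w * (1 / 2) + a = a + w / 2 by ring, show w * 1 + a = a + w by ring] at h1
    rw [show w * (1 / 2) + a = a + w / 2 by ring, show w * 0 + a = a by ring] at h2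
    rw [h1, h2, signCorr]
    ring
  · rw [integral_indicator_Ico_mul (by linarith)]
    have h1 := integral_profile_rescale hh.ne' c z 0 1
    rw [show h * 0 + c = c by ring, show h * 1 + c = c + h by ring] at h1
    rw [h1, unitCorr]

theorem integral_halfSign_mul_foldedHilbert {b cp cm u a w c h : ℝ} (hb : 1 < b) (hw : 0 < w)
    (hh : 0 < h) :
    ∫ x, halfSign a w c h x * foldedHilbert b cp cm u (cellBump a w c h) x =
      w * h * interaction b cp cm (u * w ^ b / h) := by
  obtain ⟨R, hR⟩ := exists_cell_bound a w c h
  have hT := isTest_cellBump (a := a) (c := c) hw hh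
  rw [integral_mul_foldedHilbert hb hT (measurable_halfSign a w c h)
    (abs_halfSign_le_one a w c h) (R := R) (fun x hx => halfSign_eq_zero hw.le fun hx' =>
      absurd (hR x hx') (not_le.2 hx))]
  have hi : ∀ z : ℝ × ℝ, Integrable fun x => halfSign a w c h x * cellBump a w c h (x - z) := by
    intro z
    have hg : Integrable fun x => cellBump a w c h (x - z) :=
      (hT.continuous.integrable_of_hasCompactSupport hT.2).comp_sub_right z
    exact hg.bdd_mul (c := 1) (measurable_halfSign a w c h).aestronglyMeasurable
      (Eventually.of_forall fun x => abs_halfSign_le_one a w c h x)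
  set g : ℝ → ℝ := fun τ => h * (signCorr τ / τ * (unitCorr (u * w ^ b / h * (cp * τ ^ b)) +
    unitCorr (u * w ^ b / h * (cm * τ ^ b)))) with hg
  have hin : ∀ t ∈ Ioi (0 : ℝ),
      ∫ x, halfSign a w c h x * foldedKernel b cp cm u (cellBump a w c h) x t =
      g (w⁻¹ * t) := by
    intro t ht
    have ht' : 0 < t := ht
    simp only [foldedKernel, ← mul_div_assoc, mul_sub]
    rw [integral_div, integral_sub (hi _) (hi _), integral_halfSign_mul_cellBump hw hh,
      integral_halfSign_mul_cellBump hw hh, curve_of_pos ht', curve_neg_of_pos ht', neg_div,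
      signCorr_neg]
    have e : ∀ c' : ℝ, u * w ^ b * (c' * (w⁻¹ * t) ^ b) / h = u * (c' * t ^ b) / h := by
      intro c'
      rw [Real.mul_rpow (by positivity) ht'.le, Real.inv_rpow hw.le]
      have : w ^ b ≠ 0 := (Real.rpow_pos_of_pos hw b).ne'
      field_simp
    have e' : w⁻¹ * t = t / w := by field_simp
    simp only [hg, div_mul_eq_mul_div, e]
    rw [e']
    field_simp
    ring
  rw [setIntegral_congr_fun measurableSet_Ioi hin,
    integral_comp_mul_left_Ioi g 0 (inv_pos.2 hw)]
  simp only [hg, inv_inv, mul_zero, smul_eq_mul, integral_const_mul, interaction]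
  ring

/-- Bounded measurable functions vanishing outside a bounded set. -/
def IsWeight (θ : ℝ × ℝ → ℝ) : Prop :=
  Measurable θ ∧ ∃ B R : ℝ, (∀ x, |θ x| ≤ B) ∧ ∀ x, R < ‖x‖ → θ x = 0

namespace IsWeight

theorem zero : IsWeight fun _ => 0 :=
  ⟨measurable_const, 0, 0, fun _ => by simp, fun _ _ => rfl⟩

theorem add {θ η : ℝ × ℝ → ℝ} (hθ : IsWeight θ) (hη : IsWeight η) :
    IsWeight fun x => θ x + η x := by
  obtain ⟨h1, B, R, h2, h3⟩ := hθ
  obtain ⟨k1, B', R', k2, k3⟩ := hη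
  refine ⟨h1.add k1, B + B', max R R', fun x => (abs_add_le _ _).trans (add_le_add (h2 x) (k2 x)),
    fun x hx => ?_⟩
  simp only [h3 x ((le_max_left _ _).trans_lt hx), k3 x ((le_max_right _ _).trans_lt hx), add_zero]

theorem const_mul {θ : ℝ × ℝ → ℝ} (hθ : IsWeight θ) (c : ℝ) : IsWeight fun x => c * θ x := by
  obtain ⟨h1, B, R, h2, h3⟩ := hθ
  refine ⟨h1.const_mul c, |c| * B, R, fun x => ?_, fun x hx => by simp only [h3 x hx, mul_zero]⟩
  rw [abs_mul]
  exact mul_le_mul_of_nonneg_left (h2 x) (abs_nonneg c)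

theorem sum {ι : Type} (s : Finset ι) {θ : ι → ℝ × ℝ → ℝ} (hθ : ∀ i, IsWeight (θ i)) :
    IsWeight fun x => ∑ i ∈ s, θ i x := by
  induction s using Finset.induction_on with
  | empty => simpa using zero
  | insert i s hi ih => simpa [Finset.sum_insert hi] using (hθ i).add ih

theorem integrable {θ : ℝ × ℝ → ℝ} (hθ : IsWeight θ) : Integrable θ := by
  obtain ⟨h1, B, R, h2, h3⟩ := hθ
  refine Integrable.mono' (g := (Metric.closedBall 0 R).indicator fun _ => B)
    ((integrable_indicator_iff measurableSet_closedBall).2 (integrableOn_const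
      (isCompact_closedBall (0 : ℝ × ℝ) R).measure_lt_top.ne)) h1.aestronglyMeasurable
    (Eventually.of_forall fun x => ?_)
  by_cases hx : x ∈ Metric.closedBall (0 : ℝ × ℝ) R
  · simpa [hx] using h2 x
  · rw [h3 x (by simpa using hx)]
    simp [hx]

theorem indicator_one {S : Set (ℝ × ℝ)} (hS : MeasurableSet S) {R : ℝ} (hR : ∀ x ∈ S, ‖x‖ ≤ R) :
    IsWeight (S.indicator 1) := by
  refine ⟨measurable_one.indicator hS, 1, R, fun x => ?_, fun x hx =>
    indicator_of_notMem (fun h => absurd (hR x h) (not_le.2 hx)) _⟩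
  by_cases hx : x ∈ S <;> simp [hx]

end IsWeight

theorem IsTest.isWeight {f : ℝ × ℝ → ℝ} (hf : IsTest f) : IsWeight f := by
  obtain ⟨ρ, -, hρ⟩ := hf.exists_bound
  obtain ⟨C, hC⟩ := hf.2.exists_bound_of_continuous hf.continuous
  exact ⟨hf.continuous.measurable, C, ρ, hC, fun x hx => hρ x hx.le⟩

theorem IsWeight.mul {θ η : ℝ × ℝ → ℝ} (hθ : IsWeight θ) (hη : IsWeight η) :
    IsWeight fun x => θ x * η x := by
  obtain ⟨h1, B, R, h2, h3⟩ := hθ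
  obtain ⟨k1, B', R', k2, k3⟩ := hη
  refine ⟨h1.mul k1, B * B', R, fun x => ?_, fun x hx => by simp only [h3 x hx, zero_mul]⟩
  rw [abs_mul]
  exact mul_le_mul (h2 x) (k2 x) (abs_nonneg _) ((abs_nonneg _).trans (h2 x))

/-- The pairing of a weight with the Hilbert transform of a test function. -/
def pairing (b cp cm u : ℝ) (θ f : ℝ × ℝ → ℝ) : ℝ := ∫ x, θ x * foldedHilbert b cp cm u f x

section pairing

variable {b cp cm u : ℝ} {θ η f g : ℝ × ℝ → ℝ}

theorem IsWeight.integrable_mul (hb : 1 < b) (hθ : IsWeight θ) (hf : IsTest f) :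
    Integrable fun x => θ x * foldedHilbert b cp cm u f x := by
  obtain ⟨h1, B, R, h2, h3⟩ := hθ
  exact integrable_mul_foldedHilbert hb hf h1 h2 h3

theorem pairing_add_left (hb : 1 < b) (hθ : IsWeight θ) (hη : IsWeight η) (hf : IsTest f) :
    pairing b cp cm u (fun x => θ x + η x) f = pairing b cp cm u θ f + pairing b cp cm u η f := by
  simp only [pairing, add_mul]
  exact integral_add (hθ.integrable_mul hb hf) (hη.integrable_mul hb hf)

theorem pairing_add_right (hb : 1 < b) (hθ : IsWeight θ) (hf : IsTest f) (hg : IsTest g) :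
    pairing b cp cm u θ (fun x => f x + g x) = pairing b cp cm u θ f + pairing b cp cm u θ g := by
  simp only [pairing, foldedHilbert_add hb hf hg, mul_add]
  exact integral_add (hθ.integrable_mul hb hf) (hθ.integrable_mul hb hg)

theorem pairing_const_mul_left (c : ℝ) :
    pairing b cp cm u (fun x => c * θ x) f = c * pairing b cp cm u θ f := by
  simp only [pairing, mul_assoc, integral_const_mul]

theorem pairing_const_mul_right (c : ℝ) :
    pairing b cp cm u θ (fun x => c * f x) = c * pairing b cp cm u θ f := by
  simp only [pairing, foldedHilbert_const_mul, mul_left_comm, integral_const_mul]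

theorem pairing_sum_left (hb : 1 < b) (hf : IsTest f) {ι : Type} (s : Finset ι) (w : ι → ℝ)
    {θ : ι → ℝ × ℝ → ℝ} (hθ : ∀ i, IsWeight (θ i)) :
    pairing b cp cm u (fun x => ∑ i ∈ s, w i * θ i x) f = ∑ i ∈ s, w i * pairing b cp cm u (θ i) f := by
  simp only [pairing, Finset.sum_mul, mul_assoc]
  rw [integral_finsetSum _ fun i _ => ((hθ i).integrable_mul hb hf).const_mul (w i)]
  simp only [integral_const_mul]

theorem pairing_sum_right (hb : 1 < b) (hθ : IsWeight θ) {ι : Type} (s : Finset ι) (w : ι → ℝ)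
    {f : ι → ℝ × ℝ → ℝ} (hf : ∀ i, IsTest (f i)) :
    pairing b cp cm u θ (fun x => ∑ i ∈ s, w i * f i x) = ∑ i ∈ s, w i * pairing b cp cm u θ (f i) := by
  simp only [pairing, (foldedHilbert_sum hb s w hf _).2, Finset.mul_sum, mul_left_comm (θ _)]
  rw [integral_finsetSum _ fun i _ => (hθ.integrable_mul hb (hf i)).const_mul (w i)]
  simp only [integral_const_mul]

theorem pairing_zero_right : pairing b cp cm u θ (fun _ => 0) = 0 := by
  simp [pairing, foldedHilbert_zero]

end pairing

/-- A finite random family of test functions `f` living on a set `S`, together with random weights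
`θ` subordinate to the indicator function of `S` and indexed by a finite set of parameters. -/
structure RandomTest (A : Finset ℝ) (S : Set (ℝ × ℝ)) where
  Ω : Type
  [fintype : Fintype Ω]
  w : Ω → ℝ
  f : Ω → ℝ × ℝ → ℝ
  θ : Ω → ℝ → ℝ × ℝ → ℝ
  w_nonneg : ∀ ω, 0 ≤ w ω
  w_sum : ∑ ω, w ω = 1
  f_isTest : ∀ ω, IsTest (f ω)
  f_zero : ∀ ω, ∀ x ∉ S, f ω x = 0
  f_mean : ∀ x, ∑ ω, w ω * f ω x = 0
  θ_isWeight : ∀ ω u, IsWeight (θ ω u)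
  θ_nonneg : ∀ ω u x, 0 ≤ θ ω u x
  θ_zero : ∀ ω u, ∀ x ∉ S, θ ω u x = 0
  θ_sum : ∀ ω x, ∑ u ∈ A, θ ω u x ≤ 1

attribute [instance] RandomTest.fintype

namespace RandomTest

variable {A : Finset ℝ} {S S₁ S₂ : Set (ℝ × ℝ)}

/-- The mean of the weight of index `u`. -/
def prob (F : RandomTest A S) (u : ℝ) (x : ℝ × ℝ) : ℝ := ∑ ω, F.w ω * F.θ ω u x

/-- The mean of the squared norm. -/
def energy (F : RandomTest A S) : ℝ := ∑ ω, F.w ω * ∫ x, F.f ω x ^ 2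

/-- The mean of the total pairing. -/
def gain (b cp cm : ℝ) (F : RandomTest A S) : ℝ :=
  ∑ ω, F.w ω * ∑ u ∈ A, pairing b cp cm u (F.θ ω u) (F.f ω)

theorem isWeight_prob (F : RandomTest A S) (u : ℝ) : IsWeight (F.prob u) :=
  IsWeight.sum _ fun ω => (F.θ_isWeight ω u).const_mul (F.w ω)

theorem sum_pairing_eq_zero {b cp cm u : ℝ} (hb : 1 < b) (F : RandomTest A S) {θ : ℝ × ℝ → ℝ}
    (hθ : IsWeight θ) : ∑ ω, F.w ω * pairing b cp cm u θ (F.f ω) = 0 := by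
  rw [← pairing_sum_right hb hθ _ _ F.f_isTest]
  simp only [F.f_mean]
  exact pairing_zero_right

theorem exists_single {S : Set (ℝ × ℝ)} (hS : MeasurableSet S) {R : ℝ} (hR : ∀ x ∈ S, ‖x‖ ≤ R)
    {b cp cm : ℝ} (A : Finset ℝ) (v : ℝ) : ∃ F : RandomTest A S,
      (∀ u x, F.prob u x = (if u = v then 1 else 0) * S.indicator 1 x) ∧ F.energy = 0 ∧
        F.gain b cp cm = 0 := by
  refine ⟨{ Ω := Unit
            w := fun _ => 1
            f := fun _ _ => 0
            θ := fun _ u x => (if u = v then 1 else 0) * S.indicator 1 x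
            w_nonneg := fun _ => zero_le_one
            w_sum := by simp
            f_isTest := fun _ => IsTest.zero
            f_zero := fun _ _ _ => rfl
            f_mean := fun _ => by simp
            θ_isWeight := fun _ u => (IsWeight.indicator_one hS hR).const_mul _
            θ_nonneg := fun _ u x => mul_nonneg (by split_ifs <;> simp)
              (indicator_nonneg (fun _ _ => zero_le_one) x)
            θ_zero := fun _ u x hx => by simp [hx]
            θ_sum := fun _ x => ?_ }, ?_, ?_, ?_⟩
  · rw [← Finset.sum_mul, Finset.sum_ite_eq']
    by_cases hx : x ∈ S <;> simp only [hx, indicator_of_mem, indicator_of_notMem, not_false_eq_true]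
    · split_ifs <;> simp
    · simp
  · intro u x
    simp [prob]
  · simp [energy]
  · simp [gain, pairing_zero_right]

theorem exists_glue {b cp cm : ℝ} (hb : 1 < b) (F : RandomTest A S₁) (G : RandomTest A S₂)
    (hd : Disjoint S₁ S₂) : ∃ H : RandomTest A (S₁ ∪ S₂),
      (∀ u x, H.prob u x = F.prob u x + G.prob u x) ∧ H.energy = F.energy + G.energy ∧
        H.gain b cp cm = F.gain b cp cm + G.gain b cp cm := by
  have h1 : ∀ a : F.Ω → ℝ, ∑ z : F.Ω × G.Ω, F.w z.1 * G.w z.2 * a z.1 = ∑ ω, F.w ω * a ω := by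
    intro a
    rw [Fintype.sum_prod_type]
    refine Finset.sum_congr rfl fun ω _ => ?_
    simp only
    rw [← Finset.sum_mul, ← Finset.mul_sum, G.w_sum, mul_one]
  have h2 : ∀ a : G.Ω → ℝ, ∑ z : F.Ω × G.Ω, F.w z.1 * G.w z.2 * a z.2 = ∑ ω, G.w ω * a ω := by
    intro a
    rw [Fintype.sum_prod_type_right]
    refine Finset.sum_congr rfl fun ω _ => ?_
    simp only
    rw [← Finset.sum_mul, ← Finset.sum_mul, F.w_sum, one_mul]
  refine ⟨{ Ω := F.Ω × G.Ω
            w := fun z => F.w z.1 * G.w z.2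
            f := fun z x => F.f z.1 x + G.f z.2 x
            θ := fun z u x => F.θ z.1 u x + G.θ z.2 u x
            w_nonneg := fun z => mul_nonneg (F.w_nonneg _) (G.w_nonneg _)
            w_sum := by simpa [F.w_sum] using h1 fun _ => 1
            f_isTest := fun z => (F.f_isTest _).add (G.f_isTest _)
            f_zero := fun z x hx => ?_
            f_mean := fun x => ?_
            θ_isWeight := fun z u => (F.θ_isWeight _ u).add (G.θ_isWeight _ u)
            θ_nonneg := fun z u x => add_nonneg (F.θ_nonneg _ _ _) (G.θ_nonneg _ _ _)
            θ_zero := fun z u x hx => ?_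
            θ_sum := fun z x => ?_ }, ?_, ?_, ?_⟩
  · rw [mem_union, not_or] at hx
    rw [F.f_zero _ x hx.1, G.f_zero _ x hx.2, add_zero]
  · simp only [mul_add, Finset.sum_add_distrib]
    rw [h1 fun ω => F.f ω x, h2 fun ω => G.f ω x, F.f_mean, G.f_mean, add_zero]
  · rw [mem_union, not_or] at hx
    rw [F.θ_zero _ u x hx.1, G.θ_zero _ u x hx.2, add_zero]
  · rw [Finset.sum_add_distrib]
    by_cases hx : x ∈ S₁
    · simp only [G.θ_zero _ _ x (disjoint_left.1 hd hx), Finset.sum_const_zero, add_zero]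
      exact F.θ_sum _ x
    · simp only [F.θ_zero _ _ x hx, Finset.sum_const_zero, zero_add]
      exact G.θ_sum _ x
  · intro u x
    simp only [prob, mul_add, Finset.sum_add_distrib]
    rw [h1 fun ω => F.θ ω u x, h2 fun ω => G.θ ω u x]
  · have e : ∀ z : F.Ω × G.Ω, ∫ x, (F.f z.1 x + G.f z.2 x) ^ 2 =
        (∫ x, F.f z.1 x ^ 2) + ∫ x, G.f z.2 x ^ 2 := by
      intro z
      have i1 : Integrable fun x => F.f z.1 x ^ 2 := by
        simpa only [sq] using
          ((F.f_isTest z.1).isWeight.mul (F.f_isTest z.1).isWeight).integrable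
      have i2 : Integrable fun x => G.f z.2 x ^ 2 := by
        simpa only [sq] using
          ((G.f_isTest z.2).isWeight.mul (G.f_isTest z.2).isWeight).integrable
      rw [← integral_add i1 i2]
      congr 1; ext x
      by_cases hx : x ∈ S₁
      · rw [G.f_zero _ x (disjoint_left.1 hd hx)]; ring
      · rw [F.f_zero _ x hx]; ring
    simp only [energy, e, mul_add, Finset.sum_add_distrib]
    rw [h1 fun ω => ∫ x, F.f ω x ^ 2, h2 fun ω => ∫ x, G.f ω x ^ 2]
  · have e : ∀ (z : F.Ω × G.Ω) (u : ℝ),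
        pairing b cp cm u (fun x => F.θ z.1 u x + G.θ z.2 u x) (fun x => F.f z.1 x + G.f z.2 x) =
        pairing b cp cm u (F.θ z.1 u) (F.f z.1) + pairing b cp cm u (G.θ z.2 u) (G.f z.2) +
        (pairing b cp cm u (F.θ z.1 u) (G.f z.2) + pairing b cp cm u (G.θ z.2 u) (F.f z.1)) := by
      intro z u
      rw [pairing_add_right hb ((F.θ_isWeight _ u).add (G.θ_isWeight _ u)) (F.f_isTest _)
        (G.f_isTest _), pairing_add_left hb (F.θ_isWeight _ u) (G.θ_isWeight _ u) (F.f_isTest _),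
        pairing_add_left hb (F.θ_isWeight _ u) (G.θ_isWeight _ u) (G.f_isTest _)]
      ring
    simp only [gain, e, mul_add, Finset.sum_add_distrib]
    rw [h1 fun ω => ∑ u ∈ A, pairing b cp cm u (F.θ ω u) (F.f ω),
      h2 fun ω => ∑ u ∈ A, pairing b cp cm u (G.θ ω u) (G.f ω)]
    have c1 : ∑ z : F.Ω × G.Ω, F.w z.1 * G.w z.2 *
        ∑ u ∈ A, pairing b cp cm u (F.θ z.1 u) (G.f z.2) = 0 := by
      rw [Fintype.sum_prod_type]
      refine Finset.sum_eq_zero fun ω _ => ?_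
      simp only [Finset.mul_sum]
      rw [Finset.sum_comm]
      refine Finset.sum_eq_zero fun u _ => ?_
      simp only [mul_assoc]
      rw [← Finset.mul_sum, G.sum_pairing_eq_zero hb (F.θ_isWeight ω u), mul_zero]
    have c2 : ∑ z : F.Ω × G.Ω, F.w z.1 * G.w z.2 *
        ∑ u ∈ A, pairing b cp cm u (G.θ z.2 u) (F.f z.1) = 0 := by
      rw [Fintype.sum_prod_type_right]
      refine Finset.sum_eq_zero fun ω _ => ?_
      simp only [Finset.mul_sum]
      rw [Finset.sum_comm]
      refine Finset.sum_eq_zero fun u _ => ?_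
      simp only [mul_right_comm _ (G.w ω)]
      rw [← Finset.sum_mul, F.sum_pairing_eq_zero hb (G.θ_isWeight ω u), zero_mul]
    rw [c1, c2, add_zero, add_zero]

theorem sum_sq_add (F : RandomTest A S) {ψ : ℝ × ℝ → ℝ} (hψ : IsTest ψ) :
    ∑ ω, F.w ω * ∫ x, (F.f ω x + ψ x) ^ 2 = F.energy + ∫ x, ψ x ^ 2 := by
  have i : ∀ {g h : ℝ × ℝ → ℝ}, IsTest g → IsTest h → Integrable fun x => g x * h x :=
    fun hg hh => (hg.isWeight.mul hh.isWeight).integrable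
  have e : ∀ ω, ∫ x, (F.f ω x + ψ x) ^ 2 =
      (∫ x, F.f ω x ^ 2) + (∫ x, ψ x ^ 2) + 2 * ∫ x, F.f ω x * ψ x := by
    intro ω
    simp only [sq]
    rw [← integral_const_mul, ← integral_add (i (F.f_isTest ω) (F.f_isTest ω)) (i hψ hψ),
      ← integral_add (f := fun x => F.f ω x * F.f ω x + ψ x * ψ x)
        ((i (F.f_isTest ω) (F.f_isTest ω)).add (i hψ hψ)) ((i (F.f_isTest ω) hψ).const_mul 2)]
    congr 1; ext x; ring
  have z : ∑ ω, F.w ω * ∫ x, F.f ω x * ψ x = 0 := by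
    simp only [← integral_const_mul]
    rw [← integral_finsetSum _ fun ω _ => (i (F.f_isTest ω) hψ).const_mul (F.w ω)]
    simp only [← mul_assoc, ← Finset.sum_mul, F.f_mean, zero_mul, integral_zero]
  simp only [e, mul_add, Finset.sum_add_distrib, mul_left_comm _ (2 : ℝ)]
  rw [← Finset.mul_sum, z, ← Finset.sum_mul, F.w_sum, energy]
  ring

theorem sum_pairing_add {b cp cm : ℝ} (hb : 1 < b) (F : RandomTest A S) {ψ : ℝ × ℝ → ℝ}
    (hψ : IsTest ψ) :
    ∑ ω, F.w ω * ∑ u ∈ A, pairing b cp cm u (F.θ ω u) (fun x => F.f ω x + ψ x) =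
      F.gain b cp cm + ∑ u ∈ A, pairing b cp cm u (F.prob u) ψ := by
  simp only [pairing_add_right hb (F.θ_isWeight _ _) (F.f_isTest _) hψ, Finset.sum_add_distrib,
    mul_add, gain]
  congr 1
  simp only [Finset.mul_sum]
  rw [Finset.sum_comm]
  refine Finset.sum_congr rfl fun u _ => ?_
  exact (pairing_sum_left hb hψ _ _ fun ω => F.θ_isWeight ω u).symm

theorem exists_mix {b cp cm : ℝ} (hb : 1 < b) (F G : RandomTest A S) {ψ : ℝ × ℝ → ℝ}
    (hψ : IsTest ψ) (hψS : ∀ x ∉ S, ψ x = 0) : ∃ H : RandomTest A S,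
      (∀ u x, H.prob u x = (F.prob u x + G.prob u x) / 2) ∧
      H.energy = (F.energy + G.energy) / 2 + ∫ x, ψ x ^ 2 ∧
      H.gain b cp cm = (F.gain b cp cm + G.gain b cp cm) / 2 +
        (∑ u ∈ A, (pairing b cp cm u (F.prob u) ψ - pairing b cp cm u (G.prob u) ψ)) / 2 := by
  have hψ' : IsTest fun x => -1 * ψ x := hψ.const_mul (-1)
  have e : ∀ (a : F.Ω → ℝ) (a' : G.Ω → ℝ), ∑ z : F.Ω ⊕ G.Ω,
      Sum.elim (fun ω => F.w ω / 2) (fun ω => G.w ω / 2) z * Sum.elim a a' z =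
      (∑ ω, F.w ω * a ω + ∑ ω, G.w ω * a' ω) / 2 := by
    intro a a'
    simp only [Fintype.sum_sum_type, Sum.elim_inl, Sum.elim_inr, add_div, Finset.sum_div]
    congr 1 <;> exact Finset.sum_congr rfl fun _ _ => by ring
  refine ⟨{ Ω := F.Ω ⊕ G.Ω
            w := Sum.elim (fun ω => F.w ω / 2) (fun ω => G.w ω / 2)
            f := Sum.elim (fun ω x => F.f ω x + ψ x) (fun ω x => G.f ω x + -1 * ψ x)
            θ := Sum.elim F.θ G.θ
            w_nonneg := ?_
            w_sum := ?_
            f_isTest := ?_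
            f_zero := ?_
            f_mean := fun x => ?_
            θ_isWeight := ?_
            θ_nonneg := ?_
            θ_zero := ?_
            θ_sum := ?_ }, ?_, ?_, ?_⟩
  · rintro (ω | ω)
    · exact div_nonneg (F.w_nonneg ω) zero_le_two
    · exact div_nonneg (G.w_nonneg ω) zero_le_two
  · simp only [Fintype.sum_sum_type, Sum.elim_inl, Sum.elim_inr, ← Finset.sum_div, F.w_sum, G.w_sum]
    norm_num
  · rintro (ω | ω)
    · exact (F.f_isTest ω).add hψ
    · exact (G.f_isTest ω).add hψ'
  · rintro (ω | ω) x hx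
    · simp [F.f_zero ω x hx, hψS x hx]
    · simp [G.f_zero ω x hx, hψS x hx]
  · simp only [Fintype.sum_sum_type, Sum.elim_inl, Sum.elim_inr, mul_add, Finset.sum_add_distrib,
      ← Finset.sum_mul, ← Finset.sum_div, F.w_sum, G.w_sum, div_mul_eq_mul_div, F.f_mean, G.f_mean]
    ring
  · rintro (ω | ω)
    · exact F.θ_isWeight ω
    · exact G.θ_isWeight ω
  · rintro (ω | ω)
    · exact F.θ_nonneg ω
    · exact G.θ_nonneg ω
  · rintro (ω | ω)
    · exact F.θ_zero ω
    · exact G.θ_zero ω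
  · rintro (ω | ω)
    · exact F.θ_sum ω
    · exact G.θ_sum ω
  · intro u x
    rw [prob, prob, prob, ← e]
    exact Finset.sum_congr rfl fun z _ => by rcases z with ω | ω <;> rfl
  · have h1 := F.sum_sq_add hψ
    have h2 := G.sum_sq_add hψ'
    rw [show (fun x => (-1 * ψ x) ^ 2) = fun x => ψ x ^ 2 by ext x; ring] at h2
    have h3 := e (fun ω => ∫ x, (F.f ω x + ψ x) ^ 2) (fun ω => ∫ x, (G.f ω x + -1 * ψ x) ^ 2)
    rw [h1, h2] at h3
    rw [energy]
    refine Eq.trans (Finset.sum_congr rfl fun z _ => by rcases z with ω | ω <;> rfl)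
      (h3.trans (by ring))
  · have h1 := F.sum_pairing_add (cp := cp) (cm := cm) hb hψ
    have h2 := G.sum_pairing_add (cp := cp) (cm := cm) hb hψ'
    simp only [pairing_const_mul_right] at h2
    have h3 := e (fun ω => ∑ u ∈ A, pairing b cp cm u (F.θ ω u) (fun x => F.f ω x + ψ x))
      (fun ω => ∑ u ∈ A, pairing b cp cm u (G.θ ω u) (fun x => G.f ω x + -1 * ψ x))
    rw [h1, h2, ← Finset.mul_sum] at h3
    rw [gain]
    refine Eq.trans (Finset.sum_congr rfl fun z _ => by rcases z with ω | ω <;> rfl)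
      (h3.trans ?_)
    rw [Finset.sum_sub_distrib]
    ring

end RandomTest

/-- Existence of a random family on `S`, a set of measure `μ`, whose mean weights are equidistributed
over a set `B` of `2 ^ n` indices, with energy and gain comparable to `n * μ`. -/
def HasFamily (b cp cm : ℝ) (A B : Finset ℝ) (n : ℕ) (S : Set (ℝ × ℝ)) (μ : ℝ) : Prop :=
  ∃ F : RandomTest A S, (∀ u x, F.prob u x = (if u ∈ B then (1 / 2) ^ n else 0) * S.indicator 1 x) ∧
    F.energy ≤ n * μ ∧ n * μ / 256 ≤ F.gain b cp cm

namespace HasFamily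

variable {b cp cm : ℝ} {A B : Finset ℝ} {n : ℕ}

theorem union {S₁ S₂ : Set (ℝ × ℝ)} {μ₁ μ₂ : ℝ} (hb : 1 < b) (h₁ : HasFamily b cp cm A B n S₁ μ₁)
    (h₂ : HasFamily b cp cm A B n S₂ μ₂) (hd : Disjoint S₁ S₂) :
    HasFamily b cp cm A B n (S₁ ∪ S₂) (μ₁ + μ₂) := by
  obtain ⟨F, hF, hFe, hFg⟩ := h₁
  obtain ⟨G, hG, hGe, hGg⟩ := h₂
  obtain ⟨H, hH, hHe, hHg⟩ := F.exists_glue (cp := cp) (cm := cm) hb G hd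
  refine ⟨H, fun u x => ?_, ?_, ?_⟩
  · rw [hH, hF, hG, indicator_union_of_disjoint hd, mul_add]
  · rw [hHe, mul_add]
    exact add_le_add hFe hGe
  · rw [hHg, mul_add, add_div]
    exact add_le_add hFg hGg

theorem tile_fst (hb : 1 < b) {w h : ℝ} (hw : 0 ≤ w)
    (H : ∀ a c, HasFamily b cp cm A B n (cell a w c h) (w * h)) (m : ℕ) (a c : ℝ) :
    HasFamily b cp cm A B n (cell a ((m + 1) * w) c h) ((m + 1) * w * h) := by
  induction m with
  | zero => simpa using H a c
  | succ m ih =>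
    have hd : Disjoint (cell a ((m + 1) * w) c h) (cell (a + (m + 1) * w) w c h) := by
      rw [disjoint_left]
      rintro x ⟨h1, -⟩ ⟨h2, -⟩
      exact absurd h1.2 (not_lt.2 h2.1)
    have e : cell a ((m + 1) * w) c h ∪ cell (a + (m + 1) * w) w c h =
        cell a (((m + 1 : ℕ) + 1) * w) c h := by
      unfold cell
      rw [← union_prod, Ico_union_Ico_eq_Ico (le_add_of_nonneg_right (by positivity))
        (le_add_of_nonneg_right hw)]
      congr 2
      push_cast
      ring
    have := ih.union hb (H (a + (m + 1) * w) c) hd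
    rw [e] at this
    convert this using 1
    push_cast
    ring

theorem tile_snd (hb : 1 < b) {w h : ℝ} (hh : 0 ≤ h)
    (H : ∀ a c, HasFamily b cp cm A B n (cell a w c h) (w * h)) (m : ℕ) (a c : ℝ) :
    HasFamily b cp cm A B n (cell a w c ((m + 1) * h)) (w * ((m + 1) * h)) := by
  induction m with
  | zero => simpa using H a c
  | succ m ih =>
    have hd : Disjoint (cell a w c ((m + 1) * h)) (cell a w (c + (m + 1) * h) h) := by
      rw [disjoint_left]
      rintro x ⟨-, h1⟩ ⟨-, h2⟩
      exact absurd h1.2 (not_lt.2 h2.1)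
    have e : cell a w c ((m + 1) * h) ∪ cell a w (c + (m + 1) * h) h =
        cell a w c (((m + 1 : ℕ) + 1) * h) := by
      unfold cell
      rw [← prod_union, Ico_union_Ico_eq_Ico (le_add_of_nonneg_right (by positivity))
        (le_add_of_nonneg_right hh)]
      congr 2
      push_cast
      ring
    have := ih.union hb (H a (c + (m + 1) * h)) hd
    rw [e] at this
    convert this using 1
    push_cast
    ring

end HasFamily

theorem integral_cellBump_sq_le {a w c h : ℝ} (hw : 0 < w) (hh : 0 < h) :
    ∫ x, cellBump a w c h x ^ 2 ≤ w * h := by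
  have h1 : ∫ x, cellBump a w c h x ^ 2 ≤ ∫ x, (cell a w c h).indicator 1 x := by
    refine integral_mono_of_nonneg (Eventually.of_forall fun x => sq_nonneg _) ?_
      (Eventually.of_forall fun x => ?_)
    · obtain ⟨R, hR⟩ := exists_cell_bound a w c h
      exact (IsWeight.indicator_one (measurableSet_cell a w c h) hR).integrable
    · by_cases hx : x ∈ cell a w c h
      · simpa [hx] using abs_cellBump_le_one a w c h x
      · have : cellBump a w c h x = 0 := by
          by_contra h0
          exact hx (cellBump_support_subset_cell hw hh h0)
        simp [hx, this]
  refine h1.trans (le_of_eq ?_)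
  rw [integral_indicator_one (measurableSet_cell a w c h), cell, measureReal_def,
    Measure.volume_eq_prod, Measure.prod_prod, Real.volume_Ico, Real.volume_Ico,
    ENNReal.toReal_mul, ENNReal.toReal_ofReal (by linarith), ENNReal.toReal_ofReal (by linarith)]
  ring

/-- Binary trees of positive parameters in which any two siblings are separated by a factor `K`. -/
inductive SepTree (K : ℝ) : ℕ → Finset ℝ → Prop
  | leaf {u : ℝ} (hu : 0 < u) : SepTree K 0 {u}
  | node {n : ℕ} {A B : Finset ℝ} (hA : SepTree K n A) (hB : SepTree K n B)
      (h : ∀ a ∈ A, ∀ b ∈ B, K * a ≤ b) : SepTree K (n + 1) (A ∪ B)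

namespace SepTree

variable {K : ℝ} {n : ℕ} {A B : Finset ℝ}

theorem pos (h : SepTree K n A) : ∀ u ∈ A, 0 < u := by
  induction h with
  | leaf hu => simpa using hu
  | node _ _ _ ihA ihB =>
    intro u hu
    rcases Finset.mem_union.1 hu with hu | hu
    exacts [ihA u hu, ihB u hu]

theorem disjoint (hK : 1 < K) (hA : SepTree K n A) (h : ∀ a ∈ A, ∀ b ∈ B, K * a ≤ b) :
    Disjoint A B := by
  rw [Finset.disjoint_left]
  intro u hu hu'
  nlinarith [h u hu u hu', hA.pos u hu]

theorem card (hK : 1 < K) (h : SepTree K n A) : A.card = 2 ^ n := by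
  induction h with
  | leaf => simp
  | node hA hB h ihA ihB =>
    rw [Finset.card_union_of_disjoint (hA.disjoint hK h), ihA, ihB]
    ring

end SepTree

theorem pairing_prob_sub {b cp cm u : ℝ} (hb : 1 < b) {θ η f : ℝ × ℝ → ℝ} (hθ : IsWeight θ)
    (hη : IsWeight η) (hf : IsTest f) :
    pairing b cp cm u θ f - pairing b cp cm u η f =
      pairing b cp cm u (fun x => θ x - η x) f := by
  simp only [pairing, sub_mul]
  exact (integral_sub (hθ.integrable_mul hb hf) (hη.integrable_mul hb hf)).symm

theorem HasFamily.node {b cp cm : ℝ} (hb : 1 < b) {A B C : Finset ℝ} {n : ℕ}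
    (hBC : Disjoint B C) (hBA : B ⊆ A) (hCA : C ⊆ A) (hBn : B.card = 2 ^ n) (hCn : C.card = 2 ^ n)
    {a w c h : ℝ} (hw : 0 < w) (hh : 0 < h)
    (hB : ∀ a, HasFamily b cp cm A B n (cell a (w / 2) c h) (w / 2 * h))
    (hC : ∀ a, HasFamily b cp cm A C n (cell a (w / 2) c h) (w / 2 * h))
    (hlo : ∀ u ∈ B, 1 / 64 ≤ interaction b cp cm (u * w ^ b / h))
    (hup : ∀ u ∈ C, interaction b cp cm (u * w ^ b / h) ≤ 1 / 128) :
    HasFamily b cp cm A (B ∪ C) (n + 1) (cell a w c h) (w * h) := by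
  obtain ⟨F₁, hF₁, hF₁e, hF₁g⟩ := hB (a + w / 2)
  obtain ⟨G₁, hG₁, hG₁e, hG₁g⟩ := hC a
  obtain ⟨F₂, hF₂, hF₂e, hF₂g⟩ := hB a
  obtain ⟨G₂, hG₂, hG₂e, hG₂g⟩ := hC (a + w / 2)
  obtain ⟨H₁, hH₁, hH₁e, hH₁g⟩ := G₁.exists_glue (cp := cp) (cm := cm) hb F₁ cell_halves_disjoint
  obtain ⟨H₂, hH₂, hH₂e, hH₂g⟩ := F₂.exists_glue (cp := cp) (cm := cm) hb G₂ cell_halves_disjoint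
  have hψ := isTest_cellBump (a := a) (c := c) hw hh
  obtain ⟨F, hF, hFe, hFg⟩ := H₁.exists_mix (cp := cp) (cm := cm) hb H₂ hψ (by
    intro x hx
    by_contra h0
    rw [cell_halves_union hw.le] at hx
    exact hx (cellBump_support_subset_cell hw hh h0))
  rw [← cell_halves_union hw.le]
  have hnm : ∀ u, u ∈ B → u ∉ C := fun u hu => Finset.disjoint_left.1 hBC hu
  have hJ : ∀ u, pairing b cp cm u (H₁.prob u) (cellBump a w c h) -
      pairing b cp cm u (H₂.prob u) (cellBump a w c h) =
      (1 / 2) ^ n * (w * h) * ((if u ∈ B then interaction b cp cm (u * w ^ b / h) else 0) -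
        (if u ∈ C then interaction b cp cm (u * w ^ b / h) else 0)) := by
    intro u
    rw [pairing_prob_sub hb (H₁.isWeight_prob u) (H₂.isWeight_prob u) hψ]
    have e : (fun x => H₁.prob u x - H₂.prob u x) = fun x =>
        ((1 / 2) ^ n * ((if u ∈ B then 1 else 0) - (if u ∈ C then 1 else 0))) *
          halfSign a w c h x := by
      ext x
      rw [hH₁, hH₂, hF₁, hG₁, hF₂, hG₂, halfSign]
      split_ifs <;> ring
    rw [e, pairing_const_mul_left, pairing, integral_halfSign_mul_foldedHilbert hb hw hh]
    split_ifs <;> ring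
  have hsum : (1 / 128 : ℝ) * (w * h) ≤ ∑ u ∈ A, (pairing b cp cm u (H₁.prob u) (cellBump a w c h) -
      pairing b cp cm u (H₂.prob u) (cellBump a w c h)) := by
    simp only [hJ]
    rw [← Finset.mul_sum, Finset.sum_sub_distrib, ← Finset.sum_filter, ← Finset.sum_filter,
      Finset.filter_mem_eq_inter, Finset.filter_mem_eq_inter, Finset.inter_eq_right.2 hBA,
      Finset.inter_eq_right.2 hCA]
    have h1 := Finset.card_nsmul_le_sum B _ _ hlo
    have h2 := Finset.sum_le_card_nsmul C _ _ hup
    rw [hBn, nsmul_eq_mul] at h1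
    rw [hCn, nsmul_eq_mul] at h2
    push_cast at h1 h2
    have h3 : (1 / 2 : ℝ) ^ n * 2 ^ n = 1 := by rw [← mul_pow]; norm_num
    have h4 : (2 : ℝ) ^ n * (1 / 128) ≤ ∑ u ∈ B, interaction b cp cm (u * w ^ b / h) -
        ∑ u ∈ C, interaction b cp cm (u * w ^ b / h) := by linarith
    calc (1 / 128 : ℝ) * (w * h) = (1 / 2 : ℝ) ^ n * (w * h) * (2 ^ n * (1 / 128)) := by
          linear_combination (-(1 / 128) * (w * h)) * h3
      _ ≤ _ := mul_le_mul_of_nonneg_left h4 (by positivity)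
  refine ⟨F, fun u x => ?_, ?_, ?_⟩
  · rw [hF, hH₁, hH₂, hF₁, hG₁, hF₂, hG₂, indicator_union_of_disjoint cell_halves_disjoint,
      pow_succ]
    simp only [Finset.mem_union]
    have := hnm u
    by_cases h1 : u ∈ B <;> by_cases h2 : u ∈ C
    · exact absurd h2 (this h1)
    all_goals simp only [h1, h2, if_true, if_false, or_true, or_false, or_self]; ring
  · rw [hFe, hH₁e, hH₂e]
    have := integral_cellBump_sq_le (a := a) (c := c) hw hh
    push_cast
    linarith
  · rw [hFg, hH₁g, hH₂g]
    push_cast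
    linarith

theorem exists_subdivision {b W H ρ : ℝ} (hb : 1 < b) (hW : 0 < W) (hH : 0 < H) (hρ : 0 < ρ) :
    ∃ m k : ℕ, ρ ≤ (W / (m + 1)) ^ b / (H / (k + 1)) ∧
      (W / (m + 1)) ^ b / (H / (k + 1)) ≤ 2 * ρ := by
  obtain ⟨m, hm⟩ := exists_nat_ge (W ^ b / (H * ρ))
  set q : ℝ := (W / (m + 1)) ^ b / H with hq
  have hm0 : (0 : ℝ) < m + 1 := by positivity
  have hWb : 0 < W ^ b := Real.rpow_pos_of_pos hW b
  have hq0 : 0 < q := by positivity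
  have hqρ : q ≤ ρ := by
    rw [hq, Real.div_rpow hW.le hm0.le, div_div, div_le_iff₀ (by positivity)]
    rw [div_le_iff₀ (by positivity)] at hm
    have h1 : (m : ℝ) + 1 ≤ (m + 1 : ℝ) ^ b := by
      simpa using Real.rpow_le_rpow_of_exponent_le (by linarith [(m.cast_nonneg : (0 : ℝ) ≤ m)] :
        (1 : ℝ) ≤ m + 1) hb.le
    have h2 : (m : ℝ) * (H * ρ) ≤ (m + 1 : ℝ) ^ b * (H * ρ) :=
      mul_le_mul_of_nonneg_right (by linarith) (by positivity)
    linarith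
  have hy : 1 ≤ ρ / q := (one_le_div hq0).2 hqρ
  have hc : 0 < ⌈ρ / q⌉₊ := Nat.ceil_pos.2 (by linarith)
  obtain ⟨k, hk⟩ := Nat.exists_eq_succ_of_ne_zero hc.ne'
  have e : (W / (m + 1)) ^ b / (H / (k + 1)) = q * (k + 1) := by
    rw [hq]; field_simp
  have hk' : ((⌈ρ / q⌉₊ : ℕ) : ℝ) = k + 1 := by rw [hk]; push_cast; ring
  refine ⟨m, k, ?_, ?_⟩
  · rw [e, ← hk', ← div_le_iff₀' hq0]
    exact Nat.le_ceil _
  · rw [e, ← hk']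
    have h1 := (Nat.ceil_lt_add_one (by linarith : 0 ≤ ρ / q)).le
    calc q * (⌈ρ / q⌉₊ : ℝ) ≤ q * (2 * (ρ / q)) := by gcongr; linarith
      _ = 2 * ρ := by field_simp

theorem SepTree.hasFamily {b cp cm K : ℝ} (hb : 1 < b) (hK : 1 ≤ K)
    (hgap : ∀ v : ℝ, 0 < v → (v * K ≤ 1 → 1 / 64 ≤ interaction b cp cm v) ∧
      (K ≤ v → interaction b cp cm v ≤ 1 / 128)) (A : Finset ℝ) {n : ℕ} {B : Finset ℝ}
    (hB : SepTree (2 * K ^ 2) n B) (hBA : B ⊆ A) (a w c h : ℝ) (hw : 0 < w) (hh : 0 < h) :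
    HasFamily b cp cm A B n (cell a w c h) (w * h) := by
  induction hB generalizing a w c h with
  | @leaf u hu =>
    obtain ⟨R, hR⟩ := exists_cell_bound a w c h
    obtain ⟨F, hF, hFe, hFg⟩ := RandomTest.exists_single (measurableSet_cell a w c h) hR
      (b := b) (cp := cp) (cm := cm) A u
    exact ⟨F, fun u x => by simpa using hF u x, by simp [hFe], by simp [hFg]⟩
  | @node n B C hB hC hsep ihB ihC =>
    have hK' : 1 < 2 * K ^ 2 := by nlinarith
    have hBA' := Finset.union_subset_left hBA
    have hCA' := Finset.union_subset_right hBA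
    have hCne : C.Nonempty := Finset.card_pos.1 (by rw [hC.card hK']; positivity)
    set v := C.min' hCne with hv
    have hv0 : 0 < v := hC.pos v (C.min'_mem hCne)
    obtain ⟨m, k, h1, h2⟩ := exists_subdivision hb hw hh (div_pos (by linarith : 0 < K) hv0)
    set w' := w / (m + 1) with hw'
    set h' := h / (k + 1) with hh'
    have hw'0 : 0 < w' := by positivity
    have hh'0 : 0 < h' := by positivity
    have hρ : 0 < w' ^ b / h' := div_pos (Real.rpow_pos_of_pos hw'0 b) hh'0
    have key : ∀ a c, HasFamily b cp cm A (B ∪ C) (n + 1) (cell a w' c h') (w' * h') := by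
      intro a c
      refine HasFamily.node hb (hB.disjoint hK' hsep) hBA' hCA' (hB.card hK') (hC.card hK')
        hw'0 hh'0 (fun a => ihB hBA' a _ c h' (half_pos hw'0) hh'0)
        (fun a => ihC hCA' a _ c h' (half_pos hw'0) hh'0) (fun u hu => ?_) (fun u hu => ?_)
      · rw [mul_div_assoc]
        have hu0 := hB.pos u hu
        refine (hgap _ (mul_pos hu0 hρ)).1 ?_
        have h3 := hsep u hu v (C.min'_mem hCne)
        calc u * (w' ^ b / h') * K ≤ u * (2 * (K / v)) * K := by gcongr
          _ = 2 * K ^ 2 * u / v := by ring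
          _ ≤ 1 := (div_le_one hv0).2 h3
      · rw [mul_div_assoc]
        have hu0 := hC.pos u hu
        refine (hgap _ (mul_pos hu0 hρ)).2 ?_
        have h3 : v ≤ u := C.min'_le u hu
        calc K = v * (K / v) := by field_simp
          _ ≤ u * (w' ^ b / h') := by gcongr
    have t1 := fun a c => HasFamily.tile_fst hb hw'0.le key m a c
    have t2 := HasFamily.tile_snd hb hh'0.le t1 k a c
    have e1 : (m + 1 : ℝ) * w' = w := by rw [hw']; field_simp
    have e2 : (k + 1 : ℝ) * h' = h := by rw [hh']; field_simp
    rwa [e1, e2] at t2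

/-- `C` bounds the operator norm of `𝓗^U` on `L^p`. -/
def IsBound (b cp cm : ℝ) (U : Set ℝ) (p : ℝ) (C : ℝ≥0∞) : Prop :=
  ∀ f : SchwartzMap (ℝ × ℝ) ℝ, lpN (calH b cp cm U ⇑f) p ≤ C * eLpNorm ⇑f (eN p) volume

section IsBound

variable {b cp cm p : ℝ} {U : Set ℝ} {C : ℝ≥0∞} {A : Finset ℝ}

theorem IsBound.lpN_le (hC : IsBound b cp cm U p C) {f : ℝ × ℝ → ℝ} (hf : IsTest f) :
    lpN (calH b cp cm U f) p ≤ C * eLpNorm f (eN p) volume :=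
  hC (hf.2.toSchwartzMap hf.1)

theorem enorm_foldedHilbert_le_calH (hb : 1 < b) {f : ℝ × ℝ → ℝ} (hf : IsTest f) {u : ℝ}
    (hu : u ∈ U) (x : ℝ × ℝ) : ‖foldedHilbert b cp cm u f x‖ₑ ≤ calH b cp cm U f x := by
  rw [← Hu_eq_foldedHilbert hb hf, Real.enorm_eq_ofReal_abs]
  exact le_iSup (fun u : U => ENNReal.ofReal |Hu b cp cm (u : ℝ) f x|) ⟨u, hu⟩

theorem enorm_sum_mul_foldedHilbert_le (hb : 1 < b) {f : ℝ × ℝ → ℝ} (hf : IsTest f)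
    (hAU : ↑A ⊆ U) {θ : ℝ → ℝ} (h0 : ∀ u, 0 ≤ θ u) (h1 : ∑ u ∈ A, θ u ≤ 1) (x : ℝ × ℝ) :
    ‖∑ u ∈ A, θ u * foldedHilbert b cp cm u f x‖ₑ ≤ calH b cp cm U f x := by
  calc ‖∑ u ∈ A, θ u * foldedHilbert b cp cm u f x‖ₑ
      ≤ ∑ u ∈ A, ‖θ u * foldedHilbert b cp cm u f x‖ₑ := enorm_sum_le _ _
    _ ≤ ∑ u ∈ A, ENNReal.ofReal (θ u) * calH b cp cm U f x := by
        refine Finset.sum_le_sum fun u hu => ?_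
        rw [enorm_mul, Real.enorm_of_nonneg (h0 u)]
        gcongr
        exact enorm_foldedHilbert_le_calH hb hf (hAU hu) x
    _ = ENNReal.ofReal (∑ u ∈ A, θ u) * calH b cp cm U f x := by
        rw [← Finset.sum_mul, ENNReal.ofReal_sum_of_nonneg fun u _ => h0 u]
    _ ≤ 1 * calH b cp cm U f x := by
        gcongr
        exact ENNReal.ofReal_le_one.2 h1
    _ = _ := one_mul _

theorem sum_pairing_le (hb : 1 < b) (hp1 : 1 < p) (hp2 : p ≤ 2) (hC : IsBound b cp cm U p C)
    (hCt : C ≠ ⊤) (hAU : ↑A ⊆ U) {S : Set (ℝ × ℝ)} (hS1 : volume S = 1)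
    {f : ℝ × ℝ → ℝ} (hf : IsTest f) (hfS : ∀ x ∉ S, f x = 0) {θ : ℝ → ℝ × ℝ → ℝ}
    (hθ : ∀ u, IsWeight (θ u)) (h0 : ∀ u x, 0 ≤ θ u x) (hθS : ∀ u, ∀ x ∉ S, θ u x = 0)
    (h1 : ∀ x, ∑ u ∈ A, θ u x ≤ 1) :
    ∑ u ∈ A, pairing b cp cm u (θ u) f ≤ C.toReal * √(∫ x, f x ^ 2) := by
  have hp0 : 0 < p := by linarith
  have : IsProbabilityMeasure (volume.restrict S) := ⟨by simpa using hS1⟩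
  set g : ℝ × ℝ → ℝ := fun x => ∑ u ∈ A, θ u x * foldedHilbert b cp cm u f x with hg
  have hgi : Integrable g := integrable_finsetSum _ fun u _ => (hθ u).integrable_mul hb hf
  have hsum : ∑ u ∈ A, pairing b cp cm u (θ u) f = ∫ x, g x := by
    rw [hg, integral_finsetSum _ fun u _ => (hθ u).integrable_mul hb hf]
    rfl
  have hgS : Function.support g ⊆ S := by
    intro x hx
    by_contra hxS
    exact hx (Finset.sum_eq_zero fun u _ => by rw [hθS u x hxS, zero_mul])
  have hfS' : Function.support f ⊆ S := fun x hx => by_contra fun h => hx (hfS x h)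
  have e1 : eN p ≠ 0 := by simpa [eN] using hp0
  have e2 : eN p ≠ ⊤ := ENNReal.ofReal_ne_top
  have e3 : (eN p).toReal = p := ENNReal.toReal_ofReal hp0.le
  have k1 : eLpNorm g 1 volume ≤ eLpNorm g (eN p) volume := by
    rw [← eLpNorm_restrict_eq_of_support_subset (p := 1) hgS,
      ← eLpNorm_restrict_eq_of_support_subset (p := eN p) hgS]
    exact eLpNorm_le_eLpNorm_of_exponent_le (by simpa [eN] using hp1.le)
      hgi.aestronglyMeasurable.restrict
  have k2 : eLpNorm g (eN p) volume ≤ lpN (calH b cp cm U f) p := by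
    rw [eLpNorm_eq_lintegral_rpow_enorm_toReal e1 e2, e3, lpN]
    gcongr with x
    exact enorm_sum_mul_foldedHilbert_le hb hf hAU (fun u => h0 u x) (h1 x) x
  have k3 : eLpNorm f (eN p) volume ≤ eLpNorm f 2 volume := by
    rw [← eLpNorm_restrict_eq_of_support_subset (p := eN p) hfS',
      ← eLpNorm_restrict_eq_of_support_subset (p := 2) hfS']
    refine eLpNorm_le_eLpNorm_of_exponent_le ?_ hf.continuous.aestronglyMeasurable
    simpa [eN] using ENNReal.ofReal_le_ofReal hp2
  have k4 : eLpNorm f 2 volume = ENNReal.ofReal √(∫ x, f x ^ 2) := by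
    rw [(hf.continuous.memLp_of_hasCompactSupport hf.2).eLpNorm_eq_integral_rpow_norm
      two_ne_zero ENNReal.ofNat_ne_top, Real.sqrt_eq_rpow]
    simp
  have k5 : ENNReal.ofReal (∫ x, g x) ≤ eLpNorm g 1 volume := by
    rw [eLpNorm_one_eq_lintegral_enorm, ← ofReal_integral_norm_eq_lintegral_enorm hgi]
    exact ENNReal.ofReal_le_ofReal ((le_abs_self _).trans (norm_integral_le_integral_norm g))
  have k6 : ENNReal.ofReal (∫ x, g x) ≤ C * ENNReal.ofReal √(∫ x, f x ^ 2) := by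
    rw [← k4]
    exact k5.trans (k1.trans (k2.trans ((hC.lpN_le hf).trans (by gcongr))))
  rw [hsum]
  rw [← ENNReal.ofReal_toReal hCt, ← ENNReal.ofReal_mul ENNReal.toReal_nonneg] at k6
  exact (ENNReal.ofReal_le_ofReal_iff (by positivity)).1 k6

theorem volume_unit_cell : volume (cell 0 1 0 1) = 1 := by
  rw [cell, Measure.volume_eq_prod, Measure.prod_prod, Real.volume_Ico]
  simp

theorem sqrt_le_of_sepTree {K : ℝ} (hb : 1 < b) (hp1 : 1 < p) (hp2 : p ≤ 2) (hK : 1 ≤ K)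
    (hgap : ∀ v : ℝ, 0 < v → (v * K ≤ 1 → 1 / 64 ≤ interaction b cp cm v) ∧
      (K ≤ v → interaction b cp cm v ≤ 1 / 128)) (hC : IsBound b cp cm U p C)
    (hCt : C ≠ ⊤) (hAU : ↑A ⊆ U) {n : ℕ} (hA : SepTree (2 * K ^ 2) n A) :
    √n / 256 ≤ C.toReal := by
  rcases Nat.eq_zero_or_pos n with rfl | hn
  · simp
  have hn' : (0 : ℝ) < √n := Real.sqrt_pos.2 (by exact_mod_cast hn)
  have hnn : √(n : ℝ) * √n = n := Real.mul_self_sqrt (by positivity)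
  obtain ⟨F, -, hFe, hFg⟩ := hA.hasFamily hb hK hgap A subset_rfl 0 1 0 1 one_pos one_pos
  simp only [mul_one] at hFe hFg
  have h1 : F.gain b cp cm ≤ C.toReal * ∑ ω, F.w ω * √(∫ x, F.f ω x ^ 2) := by
    rw [RandomTest.gain, Finset.mul_sum]
    refine Finset.sum_le_sum fun ω _ => ?_
    rw [mul_left_comm]
    exact mul_le_mul_of_nonneg_left (sum_pairing_le hb hp1 hp2 hC hCt hAU volume_unit_cell
      (F.f_isTest ω) (F.f_zero ω) (F.θ_isWeight ω) (F.θ_nonneg ω) (F.θ_zero ω) (F.θ_sum ω))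
      (F.w_nonneg ω)
  have h2 : ∑ ω, F.w ω * √(∫ x, F.f ω x ^ 2) ≤ √n := by
    have h3 : ∀ ω, √(∫ x, F.f ω x ^ 2) ≤ ((∫ x, F.f ω x ^ 2) / √n + √n) / 2 := by
      intro ω
      have h4 : 0 ≤ ∫ x, F.f ω x ^ 2 := integral_nonneg fun x => sq_nonneg _
      rw [le_div_iff₀ two_pos, div_add' _ _ _ hn'.ne', le_div_iff₀ hn']
      nlinarith [Real.mul_self_sqrt h4, sq_nonneg (√(∫ x, F.f ω x ^ 2) - √n)]
    calc ∑ ω, F.w ω * √(∫ x, F.f ω x ^ 2)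
        ≤ ∑ ω, F.w ω * (((∫ x, F.f ω x ^ 2) / √n + √n) / 2) :=
          Finset.sum_le_sum fun ω _ => mul_le_mul_of_nonneg_left (h3 ω) (F.w_nonneg ω)
      _ = (F.energy / √n + √n) / 2 := by
          have : ∀ ω, F.w ω * (((∫ x, F.f ω x ^ 2) / √n + √n) / 2) =
              (F.w ω * ∫ x, F.f ω x ^ 2) * (1 / √n / 2) + F.w ω * (√n / 2) := fun ω => by ring
          simp only [this]
          rw [Finset.sum_add_distrib, ← Finset.sum_mul, ← Finset.sum_mul, F.w_sum,
            RandomTest.energy]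
          ring
      _ ≤ (n / √n + √n) / 2 := by gcongr
      _ = √n := by
          rw [div_eq_of_eq_mul hn'.ne' hnn.symm]
          ring
  have h5 : (n : ℝ) / 256 ≤ C.toReal * √n :=
    hFg.trans (h1.trans (mul_le_mul_of_nonneg_left h2 ENNReal.toReal_nonneg))
  refine le_of_mul_le_mul_right ?_ hn'
  rwa [div_mul_eq_mul_div, hnn]

end IsBound

theorem SepTree.of_sequence {K : ℝ} {N : ℕ} {u : ℕ → ℝ} (hpos : ∀ i < N, 0 < u i)
    (hsep : ∀ i j, i < j → j < N → K * u i ≤ u j) (k s : ℕ) (hs : s + 2 ^ k ≤ N) :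
    SepTree K k ((Finset.Ico s (s + 2 ^ k)).image u) := by
  induction k generalizing s with
  | zero =>
    rw [pow_zero, Nat.Ico_succ_singleton, Finset.image_singleton]
    exact .leaf (hpos s (by omega))
  | succ k ih =>
    have hk := Nat.two_pow_pos k
    have e : s + 2 ^ (k + 1) = s + 2 ^ k + 2 ^ k := by ring
    rw [e] at hs ⊢
    rw [← Finset.Ico_union_Ico_eq_Ico (Nat.le_add_right s (2 ^ k))
      (Nat.le_add_right (s + 2 ^ k) (2 ^ k)), Finset.image_union]
    refine .node (ih s (by omega)) (ih (s + 2 ^ k) hs) fun a ha b hb => ?_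
    obtain ⟨i, hi, rfl⟩ := Finset.mem_image.1 ha
    obtain ⟨j, hj, rfl⟩ := Finset.mem_image.1 hb
    rw [Finset.mem_Ico] at hi hj
    exact hsep i j (by omega) (by omega)

theorem StrictMono.add_le_int {m : ℕ} {ν : Fin m → ℤ} (hν : StrictMono ν) {i j : Fin m}
    (hij : i ≤ j) : ν i + ((j : ℕ) - (i : ℕ) : ℤ) ≤ ν j := by
  obtain ⟨j, hj⟩ := j
  induction j with
  | zero =>
    have : (i : ℕ) = 0 := Nat.le_zero.1 hij
    have : i = ⟨0, hj⟩ := Fin.ext this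
    subst this
    simp
  | succ j ih =>
    rcases hij.eq_or_lt with rfl | h
    · simp
    · have h' : (i : ℕ) < j + 1 := h
      have h1 := ih (by omega) (by change (i : ℕ) ≤ j; omega)
      have h2 : ν ⟨j, by omega⟩ < ν ⟨j + 1, hj⟩ := hν (by simp)
      push_cast at h1 ⊢
      omega

theorem exists_sepTree {U : Set ℝ} {K : ℝ} {L k : ℕ} (hL : 0 < L) (hKL : K * 2 ≤ 2 ^ L)
    (T : Finset ℤ) (hT : ∀ n ∈ T, (Icc ((2 : ℝ) ^ n) ((2 : ℝ) ^ (n + 1)) ∩ U).Nonempty)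
    (hcard : L * 2 ^ k ≤ T.card) : ∃ A : Finset ℝ, ↑A ⊆ U ∧ SepTree K k A := by
  set ν := T.orderEmbOfFin rfl with hν
  have hlt : ∀ i < 2 ^ k, L * i < T.card := fun i hi =>
    (Nat.mul_lt_mul_of_pos_left hi hL).trans_le hcard
  have hex : ∀ i : ℕ, ∃ u : ℝ, ∀ h : i < 2 ^ k, u ∈ U ∧ (2 : ℝ) ^ ν ⟨L * i, hlt i h⟩ ≤ u ∧
      u ≤ (2 : ℝ) ^ (ν ⟨L * i, hlt i h⟩ + 1) := by
    intro i
    by_cases h : i < 2 ^ k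
    · obtain ⟨u, ⟨h1, h2⟩, h3⟩ := hT _ (T.orderEmbOfFin_mem rfl ⟨L * i, hlt i h⟩)
      exact ⟨u, fun _ => ⟨h3, h1, h2⟩⟩
    · exact ⟨0, fun h' => absurd h' h⟩
  choose u hu using hex
  have hpos : ∀ i < 2 ^ k, 0 < u i := fun i hi =>
    (by positivity : (0 : ℝ) < (2 : ℝ) ^ ν ⟨L * i, hlt i hi⟩).trans_le (hu i hi).2.1
  refine ⟨_, ?_, SepTree.of_sequence (N := 2 ^ k) (u := u) hpos (fun i j hij hj => ?_) k 0 (by simp)⟩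
  · intro x hx
    obtain ⟨i, hi, rfl⟩ := Finset.mem_image.1 (Finset.mem_coe.1 hx)
    exact (hu i (by simpa using hi)).1
  · have hi := hij.trans hj
    have h1 := StrictMono.add_le_int (OrderEmbedding.strictMono ν)
      (i := ⟨L * i, hlt i hi⟩) (j := ⟨L * j, hlt j hj⟩) (Nat.mul_le_mul_left L hij.le)
    have h2 : L * i + L ≤ L * j := by
      rw [← Nat.mul_succ]
      exact Nat.mul_le_mul_left L hij
    have h3 : ν ⟨L * i, hlt i hi⟩ + L ≤ ν ⟨L * j, hlt j hj⟩ := by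
      refine le_trans ?_ h1
      have : (L : ℤ) * i + L ≤ L * j := by exact_mod_cast h2
      push_cast
      linarith
    set e := ν ⟨L * i, hlt i hi⟩
    rcases le_total K 0 with hK | hK
    · exact (mul_nonpos_of_nonpos_of_nonneg hK (hpos i hi).le).trans (hpos j hj).le
    calc K * u i ≤ K * 2 ^ (e + 1) := mul_le_mul_of_nonneg_left (hu i hi).2.2 hK
      _ = K * 2 * 2 ^ e := by rw [zpow_add_one₀ two_ne_zero]; ring
      _ ≤ 2 ^ L * 2 ^ e := by gcongr
      _ = (2 : ℝ) ^ (e + L) := by rw [zpow_add₀ two_ne_zero, zpow_natCast, mul_comm]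
      _ ≤ (2 : ℝ) ^ ν ⟨L * j, hlt j hj⟩ := zpow_le_zpow_right₀ one_le_two h3
      _ ≤ u j := (hu j hj).2.1

theorem exists_log_bound (L : ℕ) (hL : 0 < L) {m : ℕ} (hm : 0 < m) :
    ∃ k : ℕ, (k = 0 ∨ L * 2 ^ k ≤ m) ∧ Real.log (1 + m) ≤ L + 1 + k := by
  refine ⟨Nat.log 2 (m / L), ?_, ?_⟩
  · by_cases h : m / L = 0
    · simp [h]
    · right
      rw [mul_comm]
      exact (Nat.le_div_iff_mul_le hL).1 (Nat.pow_log_le_self 2 h)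
  · set k := Nat.log 2 (m / L)
    have h1 : m / L < 2 ^ (k + 1) := Nat.lt_pow_succ_log_self one_lt_two _
    have h2 : m + 1 ≤ L * 2 ^ (k + 1) := by
      rw [Nat.div_lt_iff_lt_mul hL] at h1
      rw [mul_comm]
      exact h1
    have h3 : (1 + m : ℝ) ≤ L * 2 ^ (k + 1) := by rw [add_comm]; exact_mod_cast h2
    calc Real.log (1 + m) ≤ Real.log (L * 2 ^ (k + 1)) := Real.log_le_log (by positivity) h3
      _ = Real.log L + (k + 1 : ℕ) * Real.log 2 := by
          rw [Real.log_mul (by positivity) (by positivity), Real.log_pow]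
      _ ≤ L + (k + 1 : ℕ) * 1 := by
          gcongr
          · exact Real.log_le_self (by positivity)
          · linarith [Real.log_le_sub_one_of_pos (zero_lt_two' ℝ)]
      _ = L + 1 + k := by push_cast; ring

theorem exists_sqrtLogN_le {b cp cm p : ℝ} (hb : 1 < b) (hcp : cp ≠ 0) (hcm : cm ≠ 0) (hp1 : 1 < p)
    (hp2 : p ≤ 2) {c₀ : ℝ} (hc₀ : 0 < c₀) : ∃ c : ℝ, 0 < c ∧ ∀ (U : Set ℝ) (C : ℝ≥0∞),
      IsBound b cp cm U p C → C ≠ ⊤ → c₀ ≤ C.toReal → ENNReal.ofReal c * sqrtLogN U ≤ C := by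
  obtain ⟨K, hK, hgap⟩ := exists_interaction_gap hb hcp hcm
  obtain ⟨L, hL⟩ := pow_unbounded_of_one_lt (2 * K ^ 2 * 2) (one_lt_two : (1 : ℝ) < 2)
  have hL0 : 0 < L := by
    rcases Nat.eq_zero_or_pos L with rfl | h
    · rw [pow_zero] at hL
      nlinarith
    · exact h
  set c : ℝ := (√(L + 1) / c₀ + 256)⁻¹ with hc
  have hc0 : 0 < c := by positivity
  refine ⟨c, hc0, fun U C hC hCt hCc => ?_⟩
  set D := {n : ℤ | (Icc ((2 : ℝ) ^ n) ((2 : ℝ) ^ (n + 1)) ∩ U).Nonempty} with hD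
  have key : ∀ (T : Finset ℤ) (k : ℕ), ↑T ⊆ D → L * 2 ^ k ≤ T.card → √k / 256 ≤ C.toReal := by
    intro T k hT hk
    obtain ⟨A, hAU, hA⟩ := exists_sepTree (U := U) hL0 hL.le T (fun n hn => hT hn) hk
    exact sqrt_le_of_sepTree hb hp1 hp2 hK hgap hC hCt hAU hA
  by_cases hfin : D.Finite
  · have hN : frakN U = ((1 + hfin.toFinset.card : ℕ) : ℕ∞) := by
      rw [frakN, ← hD, hfin.encard_eq_coe_toFinset_card]
      push_cast
      rfl
    have hs : sqrtLogN U = ENNReal.ofReal √(Real.log (1 + hfin.toFinset.card)) := by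
      rw [sqrtLogN, hN, if_neg (ENat.natCast_ne_top _), ENat.toNat_natCast]
      push_cast
      rfl
    rw [hs, ← ENNReal.ofReal_mul hc0.le]
    refine ENNReal.ofReal_le_of_le_toReal ?_
    rcases Nat.eq_zero_or_pos hfin.toFinset.card with h0 | h0
    · simp [h0]
    obtain ⟨k, hk, hlog⟩ := exists_log_bound L hL0 h0
    have h1 : √(k : ℝ) / 256 ≤ C.toReal := by
      rcases hk with rfl | hk
      · simp
      · exact key _ k (by simp) hk
    have h2 : √(Real.log (1 + hfin.toFinset.card)) ≤ √(L + 1) + √k :=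
      (Real.sqrt_le_sqrt hlog).trans (by
        rw [Real.sqrt_le_left (by positivity), add_sq, Real.sq_sqrt (by positivity),
          Real.sq_sqrt (by positivity)]
        nlinarith [mul_nonneg (Real.sqrt_nonneg ((L : ℝ) + 1)) (Real.sqrt_nonneg (k : ℝ))])
    rw [hc, inv_mul_le_iff₀ (by positivity)]
    have h3 : √((L : ℝ) + 1) ≤ √(L + 1) / c₀ * C.toReal := by
      rw [div_mul_eq_mul_div, le_div_iff₀ hc₀]
      gcongr
    linarith
  · exfalso
    obtain ⟨k, hk⟩ := exists_nat_gt ((256 * C.toReal) ^ 2)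
    obtain ⟨T, hT, hTc⟩ := Set.Infinite.exists_subset_card_eq hfin (L * 2 ^ k)
    have h1 := key T k hT hTc.ge
    have h2 : 256 * C.toReal < √k := by
      rw [Real.lt_sqrt (by positivity)]
      exact hk
    linarith

/-- A smooth even cutoff equal to `1` on `[-1,1]` and supported in `[-2,2]`. -/
def cutoff : ContDiffBump (0 : ℝ) := ⟨1, 2, one_pos, one_lt_two⟩

theorem cutoff_eq_one {x : ℝ} (hx : |x| ≤ 1) : cutoff x = 1 := by
  refine cutoff.one_of_mem_closedBall ?_
  rw [Metric.mem_closedBall, Real.dist_eq, sub_zero]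
  exact hx

theorem cutoff_eq_zero {x : ℝ} (hx : 2 ≤ |x|) : cutoff x = 0 := by
  refine cutoff.zero_of_le_dist ?_
  rw [Real.dist_eq, sub_zero]
  exact hx

/-- A smooth version of the indicator function of `[-ε,ε] × [-η,η]`. -/
def boxCutoff (ε η : ℝ) (x : ℝ × ℝ) : ℝ := cutoff (x.1 / ε) * cutoff (x.2 / η)

section boxCutoff

variable {ε η : ℝ}

theorem boxCutoff_nonneg (x : ℝ × ℝ) : 0 ≤ boxCutoff ε η x :=
  mul_nonneg cutoff.nonneg cutoff.nonneg

theorem boxCutoff_le_one (x : ℝ × ℝ) : boxCutoff ε η x ≤ 1 :=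
  mul_le_one₀ cutoff.le_one cutoff.nonneg cutoff.le_one

theorem boxCutoff_eq_one (hε : 0 < ε) (hη : 0 < η) {x : ℝ × ℝ} (h1 : |x.1| ≤ ε) (h2 : |x.2| ≤ η) :
    boxCutoff ε η x = 1 := by
  rw [boxCutoff, cutoff_eq_one, cutoff_eq_one, mul_one]
  · rwa [abs_div, abs_of_pos hη, div_le_one hη]
  · rwa [abs_div, abs_of_pos hε, div_le_one hε]

theorem boxCutoff_eq_zero_of_fst (hε : 0 < ε) {x : ℝ × ℝ} (h : 2 * ε ≤ |x.1|) :
    boxCutoff ε η x = 0 := by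
  rw [boxCutoff, cutoff_eq_zero, zero_mul]
  rwa [abs_div, abs_of_pos hε, le_div_iff₀ hε]

theorem boxCutoff_eq_zero_of_snd (hη : 0 < η) {x : ℝ × ℝ} (h : 2 * η ≤ |x.2|) :
    boxCutoff ε η x = 0 := by
  rw [boxCutoff, cutoff_eq_zero (x := x.2 / η), mul_zero]
  rwa [abs_div, abs_of_pos hη, le_div_iff₀ hη]

theorem boxCutoff_support (hε : 0 < ε) (hη : 0 < η) : Function.support (boxCutoff ε η) ⊆
    Icc (-(2 * ε)) (2 * ε) ×ˢ Icc (-(2 * η)) (2 * η) := by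
  intro x hx
  by_contra h
  rw [mem_prod, mem_Icc, mem_Icc, ← abs_le, ← abs_le, not_and_or, not_le, not_le] at h
  rcases h with h | h
  · exact hx (boxCutoff_eq_zero_of_fst hε h.le)
  · exact hx (boxCutoff_eq_zero_of_snd hη h.le)

theorem isTest_boxCutoff (hε : 0 < ε) (hη : 0 < η) : IsTest (boxCutoff ε η) := by
  constructor
  · unfold boxCutoff
    exact (cutoff.contDiff.comp (by fun_prop)).mul (cutoff.contDiff.comp (by fun_prop))
  · exact HasCompactSupport.of_support_subset_isCompact (isCompact_Icc.prod isCompact_Icc)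
      (boxCutoff_support hε hη)

theorem eLpNorm_boxCutoff_le (hε : 0 < ε) (hη : 0 < η) {p : ℝ} (hp : 0 < p) :
    eLpNorm (boxCutoff ε η) (eN p) volume ≤ ENNReal.ofReal ((16 * ε * η) ^ (1 / p)) := by
  set S : Set (ℝ × ℝ) := Icc (-(2 * ε)) (2 * ε) ×ˢ Icc (-(2 * η)) (2 * η) with hS
  have hSm : MeasurableSet S := measurableSet_Icc.prod measurableSet_Icc
  have h1 : eLpNorm (boxCutoff ε η) (eN p) volume ≤
      eLpNorm (S.indicator fun _ => (1 : ℝ)) (eN p) volume := by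
    refine eLpNorm_mono fun x => ?_
    rw [Real.norm_of_nonneg (boxCutoff_nonneg x)]
    by_cases hx : x ∈ S
    · simpa [hx] using boxCutoff_le_one x
    · have : boxCutoff ε η x = 0 := by
        by_contra h
        exact hx (boxCutoff_support hε hη h)
      simp [this]
  refine h1.trans (le_of_eq ?_)
  rw [eLpNorm_indicator_const hSm (p := eN p) (by simpa [eN] using hp) ENNReal.ofReal_ne_top, hS,
    Measure.volume_eq_prod, Measure.prod_prod, Real.volume_Icc, Real.volume_Icc,
    ← ENNReal.ofReal_mul (by linarith), eN, ENNReal.toReal_ofReal hp.le,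
    ENNReal.ofReal_rpow_of_nonneg (by nlinarith) (by positivity), enorm_one, one_mul]
  congr 2
  ring

end boxCutoff

theorem abs_rpow_sub_rpow_le {b s t T : ℝ} (hb : 1 ≤ b) (hs : 1 ≤ s) (ht : 1 ≤ t) (hsT : s ≤ T)
    (htT : t ≤ T) : |t ^ b - s ^ b| ≤ b * T ^ b * |t - s| := by
  wlog h : s ≤ t generalizing s t
  · rw [abs_sub_comm, abs_sub_comm t]
    exact this ht hs htT hsT (not_le.1 h).le
  have ht0 : 0 < t := by linarith
  rw [abs_of_nonneg (sub_nonneg.2 (Real.rpow_le_rpow (by linarith) h (by linarith))),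
    abs_of_nonneg (sub_nonneg.2 h)]
  have h1 := one_add_mul_self_le_rpow_one_add (s := s / t - 1)
    (by linarith [div_nonneg (by linarith : 0 ≤ s) ht0.le]) hb
  rw [add_sub_cancel, Real.div_rpow (by linarith) ht0.le, le_div_iff₀ (by positivity)] at h1
  have h2 : t ^ b ≤ T ^ b := Real.rpow_le_rpow ht0.le htT (by linarith)
  have h3 : t ^ b - s ^ b ≤ b * t ^ b * ((t - s) / t) := by
    rw [sub_div, div_self ht0.ne']
    linarith
  have h4 : (t - s) / t ≤ t - s := div_le_self (by linarith) ht
  calc t ^ b - s ^ b ≤ b * t ^ b * ((t - s) / t) := h3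
    _ ≤ b * T ^ b * (t - s) := by
        have : 0 ≤ (t - s) / t := div_nonneg (by linarith) ht0.le
        have hT : 0 ≤ b * T ^ b := mul_nonneg (by linarith) (Real.rpow_nonneg (by linarith) b)
        gcongr

theorem le_foldedHilbert_boxCutoff {b cp cm u δ η : ℝ} (hb : 1 < b) (hδ : 0 < δ) (hδ1 : δ < 1)
    (hη : 0 < η) {x : ℝ × ℝ} (hx : x.1 ∈ Icc (3 : ℝ) 4)
    (h : ∀ t, |x.1 - t| ≤ δ → |x.2 - u * (cp * t ^ b)| ≤ η) :
    2 * δ / 5 ≤ foldedHilbert b cp cm u (boxCutoff δ η) x := by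
  obtain ⟨hx3, hx4⟩ := hx
  have hT := isTest_boxCutoff hδ hη
  have hi := integrableOn_foldedKernel (cp := cp) (cm := cm) (u := u) hb hT x
  have hk : ∀ t ∈ Ioi (0 : ℝ), foldedKernel b cp cm u (boxCutoff δ η) x t =
      boxCutoff δ η (x - (t, u * (cp * t ^ b))) / t := by
    intro t ht
    have ht' : 0 < t := ht
    rw [foldedKernel, curve_of_pos ht', boxCutoff_eq_zero_of_fst (x := x - (-t, _)) hδ, sub_zero]
    rw [Prod.fst_sub, sub_neg_eq_add, abs_of_pos (by linarith)]
    linarith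
  have hsub : Icc (x.1 - δ) (x.1 + δ) ⊆ Ioi 0 := fun t ht => by
    have := ht.1
    change 0 < t
    linarith
  calc 2 * δ / 5 = ∫ _t in Icc (x.1 - δ) (x.1 + δ), (1 / 5 : ℝ) := by
        rw [setIntegral_const, measureReal_def, Real.volume_Icc, ENNReal.toReal_ofReal (by linarith),
          smul_eq_mul]
        ring
    _ ≤ ∫ t in Icc (x.1 - δ) (x.1 + δ), foldedKernel b cp cm u (boxCutoff δ η) x t := by
        refine setIntegral_mono_on (integrableOn_const (by simp)) (hi.mono_set hsub)
          measurableSet_Icc fun t ht => ?_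
        have ht' : |x.1 - t| ≤ δ := by
          rw [abs_le]
          constructor <;> linarith [ht.1, ht.2]
        rw [hk t (hsub ht), boxCutoff_eq_one hδ hη (by simpa using ht') (by simpa using h t ht')]
        exact one_div_le_one_div_of_le (hsub ht) (by linarith [ht.2])
    _ ≤ foldedHilbert b cp cm u (boxCutoff δ η) x := by
        refine setIntegral_mono_set hi ?_ hsub.eventuallyLE
        filter_upwards [ae_restrict_mem measurableSet_Ioi] with t ht
        rw [hk t ht]
        exact div_nonneg (boxCutoff_nonneg _) (le_of_lt ht)

/-- The union of the intervals `[jδ, (j+1)δ)` over `j ∈ J`. -/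
def gridSet (δ : ℝ) (J : Finset ℕ) : Set ℝ := ⋃ j ∈ J, Ico (j * δ) ((j + 1) * δ)

theorem measurableSet_gridSet (δ : ℝ) (J : Finset ℕ) : MeasurableSet (gridSet δ J) :=
  Finset.measurableSet_biUnion _ fun _ _ => measurableSet_Ico

theorem volume_gridSet {δ : ℝ} (hδ : 0 < δ) (J : Finset ℕ) :
    volume (gridSet δ J) = ENNReal.ofReal (J.card * δ) := by
  rw [gridSet, measure_biUnion_finset _ fun _ _ => measurableSet_Ico]
  · have : ∀ j : ℕ, volume (Ico (j * δ) ((j + 1) * δ)) = ENNReal.ofReal δ := fun j => by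
      rw [Real.volume_Ico]
      congr 1
      ring
    simp only [this, Finset.sum_const, nsmul_eq_mul]
    rw [ENNReal.ofReal_mul (by positivity), ENNReal.ofReal_natCast]
  · intro i _ j _ hij
    wlog h : i < j generalizing i j
    · exact (this ‹_› ‹_› hij.symm (lt_of_le_of_ne (not_lt.1 h) hij.symm)).symm
    rw [Function.onFun, disjoint_left]
    intro x hx hx'
    have h1 : (i : ℝ) + 1 ≤ j := by exact_mod_cast h
    have h2 := mul_le_mul_of_nonneg_right h1 hδ.le
    linarith [hx.2, hx'.1]

/-- The points over `[3,4]` whose ordinate lies in a multiple of `gridSet δ J` by the curve. -/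
def fanSet (b q δ : ℝ) (J : Finset ℕ) : Set (ℝ × ℝ) :=
  {x | x.1 ∈ Icc (3 : ℝ) 4 ∧ x.2 * (q * x.1 ^ b)⁻¹ ∈ gridSet δ J}

theorem measurableSet_fanSet (b q δ : ℝ) (J : Finset ℕ) : MeasurableSet (fanSet b q δ J) := by
  refine (measurable_fst measurableSet_Icc).inter ?_
  have : Measurable fun x : ℝ × ℝ => x.2 * (q * x.1 ^ b)⁻¹ := by fun_prop
  exact this (measurableSet_gridSet δ J)

theorem le_volume_fanSet {b q δ : ℝ} (hb : 0 ≤ b) (hq : q ≠ 0) (hδ : 0 < δ) (J : Finset ℕ) :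
    ENNReal.ofReal (|q| * (J.card * δ)) ≤ volume (fanSet b q δ J) := by
  rw [Measure.volume_eq_prod, Measure.prod_apply (measurableSet_fanSet b q δ J)]
  calc ENNReal.ofReal (|q| * (J.card * δ))
      = ∫⁻ _ in Icc (3 : ℝ) 4, ENNReal.ofReal (|q| * (J.card * δ)) := by
        rw [setLIntegral_const, Real.volume_Icc]
        norm_num
    _ ≤ ∫⁻ y in Icc (3 : ℝ) 4, volume (Prod.mk y ⁻¹' fanSet b q δ J) := by
        refine setLIntegral_mono' measurableSet_Icc fun y hy => ?_
        have hy0 : 1 ≤ y := by linarith [hy.1]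
        have hyb : 1 ≤ y ^ b := Real.one_le_rpow hy0 hb
        have hqy : q * y ^ b ≠ 0 := mul_ne_zero hq (by positivity)
        have e : Prod.mk y ⁻¹' fanSet b q δ J = (fun z => z * (q * y ^ b)⁻¹) ⁻¹' gridSet δ J := by
          ext z
          simp only [fanSet, mem_preimage, mem_ofPred_eq, hy, true_and]
        rw [e, Real.volume_preimage_mul_right (inv_ne_zero hqy), inv_inv, volume_gridSet hδ,
          ← ENNReal.ofReal_mul (abs_nonneg _)]
        refine ENNReal.ofReal_le_ofReal (mul_le_mul_of_nonneg_right ?_ (by positivity))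
        rw [abs_mul, abs_of_pos (by positivity : 0 < y ^ b)]
        exact le_mul_of_one_le_right (abs_nonneg q) hyb
    _ ≤ ∫⁻ y, volume (Prod.mk y ⁻¹' fanSet b q δ J) := setLIntegral_le_lintegral _ _

theorem exists_grid_bound {b cp : ℝ} (cm : ℝ) {p : ℝ} (hb : 1 < b) (hcp : cp ≠ 0) (hp1 : 1 < p) :
    ∃ c : ℝ, 0 < c ∧ ∀ (U : Set ℝ) (C : ℝ≥0∞), IsBound b cp cm U p C → C ≠ ⊤ →
      ∀ r δ : ℝ, 0 < r → 0 < δ → δ < 1 → ∀ J : Finset ℕ,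
        (∀ j ∈ J, (UrSet U r ∩ Ico (j * δ) ((j + 1) * δ)).Nonempty) →
        c * (δ ^ (1 - 1 / p) * (J.card : ℝ) ^ (1 / p)) ≤ C.toReal := by
  have hp0 : 0 < p := by linarith
  have hcp' : 0 < |cp| := abs_pos.2 hcp
  set M : ℝ := |cp| * 4 ^ b + 2 * (|cp| * (b * 5 ^ b)) with hM
  have hM0 : 0 < M := by positivity
  refine ⟨2 / 5 * (|cp| / (16 * M)) ^ (1 / p), by positivity,
    fun U C hC hCt r δ hr hδ hδ1 J hJ => ?_⟩
  set η := M * δ * r with hη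
  have hη0 : 0 < η := by positivity
  have hT := isTest_boxCutoff hδ hη0
  have hpt : ∀ x ∈ fanSet b (r * cp) δ J,
      ENNReal.ofReal (2 * δ / 5) ≤ calH b cp cm U (boxCutoff δ η) x := by
    rintro x ⟨hx, hxJ⟩
    simp only [gridSet, mem_iUnion] at hxJ
    obtain ⟨j, hj, hs1, hs2⟩ := hxJ
    obtain ⟨a, ⟨⟨ha1, ha2⟩, haU⟩, ha3, ha4⟩ := hJ j hj
    refine le_trans ?_ (enorm_foldedHilbert_le_calH hb hT haU x)
    rw [Real.enorm_eq_ofReal_abs]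
    refine ENNReal.ofReal_le_ofReal (le_trans ?_ (le_abs_self _))
    refine le_foldedHilbert_boxCutoff hb hδ hδ1 hη0 hx fun t ht => ?_
    obtain ⟨hx3, hx4⟩ := hx
    have hxb : 0 < x.1 ^ b := Real.rpow_pos_of_pos (by linarith) b
    have hxb4 : x.1 ^ b ≤ 4 ^ b := Real.rpow_le_rpow (by linarith) hx4 (by linarith)
    set s := x.2 * (r * cp * x.1 ^ b)⁻¹ with hs
    have hx2 : x.2 = s * (r * cp * x.1 ^ b) := by
      rw [hs, inv_mul_cancel_right₀ (mul_ne_zero (mul_ne_zero hr.ne' hcp) hxb.ne')]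
    have hsa : |s - a| ≤ δ := by
      rw [abs_le]
      constructor <;> linarith
    have ht' := abs_le.1 ht
    have hlip : |x.1 ^ b - t ^ b| ≤ b * 5 ^ b * δ :=
      (abs_rpow_sub_rpow_le hb.le (by linarith) (by linarith) (by linarith) (by linarith)).trans
        (mul_le_mul_of_nonneg_left ht (by positivity))
    have e : x.2 - r * a * (cp * t ^ b) =
        r * (cp * x.1 ^ b * (s - a) + a * (cp * (x.1 ^ b - t ^ b))) := by
      rw [hx2]
      ring
    rw [e, abs_mul, abs_of_pos hr, hη, mul_comm (M * δ)]
    refine mul_le_mul_of_nonneg_left ((abs_add_le _ _).trans ?_) hr.le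
    rw [abs_mul, abs_mul, abs_mul, abs_mul, abs_of_pos hxb, abs_of_pos (by linarith : 0 < a)]
    calc |cp| * x.1 ^ b * |s - a| + a * (|cp| * |x.1 ^ b - t ^ b|)
        ≤ |cp| * 4 ^ b * δ + 2 * (|cp| * (b * 5 ^ b * δ)) := by gcongr
      _ = M * δ := by rw [hM]; ring
  have h1 : ENNReal.ofReal (2 * δ / 5 * (|r * cp| * (J.card * δ)) ^ (1 / p)) ≤
      lpN (calH b cp cm U (boxCutoff δ η)) p := by
    calc ENNReal.ofReal (2 * δ / 5 * (|r * cp| * (J.card * δ)) ^ (1 / p))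
        = ENNReal.ofReal (2 * δ / 5) * ENNReal.ofReal (|r * cp| * (J.card * δ)) ^ (1 / p) := by
          rw [ENNReal.ofReal_mul (by positivity),
            ENNReal.ofReal_rpow_of_nonneg (by positivity) (by positivity)]
      _ ≤ ENNReal.ofReal (2 * δ / 5) * volume (fanSet b (r * cp) δ J) ^ (1 / p) := by
          gcongr
          exact le_volume_fanSet (by linarith) (mul_ne_zero hr.ne' hcp) hδ J
      _ = (∫⁻ _ in fanSet b (r * cp) δ J, ENNReal.ofReal (2 * δ / 5) ^ p) ^ (1 / p) := by
          rw [setLIntegral_const, ENNReal.mul_rpow_of_nonneg _ _ (by positivity), one_div,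
            ENNReal.rpow_rpow_inv hp0.ne']
      _ ≤ lpN (calH b cp cm U (boxCutoff δ η)) p := by
          unfold lpN
          refine ENNReal.rpow_le_rpow ?_ (by positivity)
          refine le_trans (setLIntegral_mono' (measurableSet_fanSet _ _ _ _) fun x hx => ?_)
            (setLIntegral_le_lintegral (fanSet b (r * cp) δ J) _)
          exact ENNReal.rpow_le_rpow (hpt x hx) hp0.le
  have h2 : 2 * δ / 5 * (|r * cp| * (J.card * δ)) ^ (1 / p) ≤
      C.toReal * (16 * δ * η) ^ (1 / p) := by
    have h3 := (h1.trans (hC.lpN_le hT)).trans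
      (mul_le_mul_right (eLpNorm_boxCutoff_le hδ hη0 hp0) C)
    rw [← ENNReal.ofReal_toReal hCt, ← ENNReal.ofReal_mul ENNReal.toReal_nonneg] at h3
    exact (ENNReal.ofReal_le_ofReal_iff (by positivity)).1 h3
  have e1 : δ ^ (1 - 1 / p) = δ * (1 / δ) ^ (1 / p) := by
    rw [Real.rpow_sub hδ, Real.rpow_one, Real.div_rpow zero_le_one hδ.le, Real.one_rpow]
    ring
  have e2 : |r * cp| * (J.card * δ) = |cp| / (16 * M) * (1 / δ) * J.card * (16 * δ * η) := by
    rw [abs_mul, abs_of_pos hr, hη]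
    field_simp
  have hY : 0 < 16 * δ * η := by positivity
  rw [e2] at h2
  generalize 16 * δ * η = Y at h2 hY
  refine le_of_mul_le_mul_right (le_trans (le_of_eq ?_) h2) (Real.rpow_pos_of_pos hY (1 / p))
  rw [e1, Real.mul_rpow (by positivity) hY.le, Real.mul_rpow (by positivity) (by positivity),
    Real.mul_rpow (by positivity) (by positivity)]
  ring

theorem exists_finset_covN_le {U : Set ℝ} {r δ : ℝ} (hδ : 0 < δ) : ∃ J : Finset ℕ,
    (∀ j ∈ J, (UrSet U r ∩ Ico (j * δ) ((j + 1) * δ)).Nonempty) ∧ covN (UrSet U r) δ ≤ J.card := by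
  set J := (Finset.range (⌊2 / δ⌋₊ + 1)).filter
    fun j : ℕ => (UrSet U r ∩ Ico (j * δ) ((j + 1) * δ)).Nonempty with hJ
  refine ⟨J, fun j hj => (Finset.mem_filter.1 hj).2, ?_⟩
  refine le_trans (Nat.sInf_le ⟨J.image fun j : ℕ => (j : ℝ) * δ, rfl, fun ρ hρ => ?_⟩)
    Finset.card_image_le
  have hρ0 : 0 ≤ ρ / δ := div_nonneg (by linarith [hρ.1.1]) hδ.le
  have h1 : (⌊ρ / δ⌋₊ : ℝ) * δ ≤ ρ := (le_div_iff₀ hδ).1 (Nat.floor_le hρ0)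
  have h2 : ρ < (⌊ρ / δ⌋₊ + 1) * δ := (div_lt_iff₀ hδ).1 (Nat.lt_floor_add_one _)
  have hmem : ⌊ρ / δ⌋₊ ∈ J := by
    refine Finset.mem_filter.2 ⟨Finset.mem_range.2 (Nat.lt_succ_of_le (Nat.floor_mono ?_)),
      ρ, hρ, h1, h2⟩
    exact div_le_div_of_nonneg_right hρ.1.2 hδ.le
  simp only [Finset.mem_image, iUnion_exists, mem_iUnion]
  exact ⟨_, _, ⟨hmem, rfl⟩, h1, by linarith⟩

theorem statement7 (b cp cm : ℝ) (hb : 1 < b) (hcp : cp ≠ 0) (hcm : cm ≠ 0) (p : ℝ) (hp1 : 1 < p) (hp2 : p ≤ 2) :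
    ∃ c : ℝ, 0 < c ∧ ∀ U : Set ℝ, U.Nonempty → U ⊆ Ioi (0:ℝ) →
      ENNReal.ofReal c *
          (sqrtLogN U
            + ⨆ δ : {δ : ℝ // 0 < δ ∧ δ < 1}, ENNReal.ofReal (Kp U (δ : ℝ) p))
        ≤ opNormH b cp cm U p := by
  obtain ⟨c₂, hc₂, h₂⟩ := exists_grid_bound cm hb hcp hp1
  obtain ⟨c₁, hc₁, h₁⟩ := exists_sqrtLogN_le hb hcp hcm hp1 hp2
    (c₀ := c₂ * (1 / 2) ^ (1 - 1 / p)) (by positivity)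
  refine ⟨min c₁ c₂ / 2, by positivity, fun U hU hU0 => le_sInf fun C hC => ?_⟩
  rcases eq_or_ne C ⊤ with rfl | hCt
  · exact le_top
  have hC' : IsBound b cp cm U p C := hC
  have k₁ : ENNReal.ofReal c₁ * sqrtLogN U ≤ C := by
    refine h₁ U C hC' hCt ?_
    obtain ⟨u, hu⟩ := hU
    have := h₂ U C hC' hCt u (1 / 2) (hU0 hu) (by norm_num) (by norm_num) {2} fun j hj => by
      rw [Finset.mem_singleton.1 hj]
      exact ⟨1, ⟨⟨le_rfl, one_le_two⟩, by simpa using hu⟩, by norm_num, by norm_num⟩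
    simpa using this
  have k₂ : ENNReal.ofReal c₂ *
      ⨆ δ : {δ : ℝ // 0 < δ ∧ δ < 1}, ENNReal.ofReal (Kp U (δ : ℝ) p) ≤ C := by
    rw [ENNReal.mul_iSup]
    refine iSup_le fun δ => ?_
    obtain ⟨δ, hδ, hδ1⟩ := δ
    rw [← ENNReal.ofReal_mul hc₂.le]
    refine ENNReal.ofReal_le_of_le_toReal ?_
    have hδp : 0 < δ ^ (1 - 1 / p) := Real.rpow_pos_of_pos hδ _
    have : Nonempty {r : ℝ // 0 < r} := ⟨⟨1, one_pos⟩⟩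
    have hsup : (⨆ r : {r : ℝ // 0 < r}, (covN (UrSet U (r : ℝ)) δ : ℝ) ^ (1 / p)) ≤
        C.toReal / (c₂ * δ ^ (1 - 1 / p)) := by
      refine ciSup_le fun r => ?_
      obtain ⟨J, hJ, hcov⟩ := exists_finset_covN_le (U := U) (r := r) hδ
      have h3 := h₂ U C hC' hCt r δ r.2 hδ hδ1 J hJ
      rw [le_div_iff₀ (by positivity)]
      refine le_trans ?_ h3
      have h4 : (covN (UrSet U (r : ℝ)) δ : ℝ) ^ (1 / p) ≤ (J.card : ℝ) ^ (1 / p) :=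
        Real.rpow_le_rpow (by positivity) (by exact_mod_cast hcov) (by positivity)
      calc (covN (UrSet U (r : ℝ)) δ : ℝ) ^ (1 / p) * (c₂ * δ ^ (1 - 1 / p))
          ≤ (J.card : ℝ) ^ (1 / p) * (c₂ * δ ^ (1 - 1 / p)) := by gcongr
        _ = _ := by ring
    rw [le_div_iff₀ (by positivity)] at hsup
    rw [Kp]
    linarith
  have hle : ∀ c, min c₁ c₂ ≤ c → ∀ a : ℝ≥0∞, ENNReal.ofReal c * a ≤ C →
      ENNReal.ofReal (min c₁ c₂ / 2) * a ≤ C / 2 := by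
    intro c hc a ha
    rw [ENNReal.ofReal_div_of_pos two_pos, ENNReal.ofReal_ofNat, ENNReal.mul_div_right_comm.symm]
    gcongr
    exact le_trans (by gcongr) ha
  rw [mul_add]
  calc _ ≤ C / 2 + C / 2 := add_le_add (hle c₁ (min_le_left _ _) _ k₁)
        (hle c₂ (min_le_right _ _) _ k₂)
    _ = C := ENNReal.add_halves C

end
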